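/- For every dimension d ≥ 2 there exist constants C > 0 and μ₀ ≥ 1, depending only on d, with the following property. Let λ ≥ 1 and μ ≥ μ₀. Let n₀, n₁ be real-valued Schwartz functions on ℝ^d whose Fourier transforms are supported in the annulus A_λ = {ξ : 8λ/9 ≤ |ξ| ≤ 9λ/4}, and let n(t) be the free wave evolution of (n₀, n₁). Let E₀ be a Schwartz function on ℝ^d whose Fourier transform is supported in A_μ ∩ {ξ = (ξ₁, ξ') ∈ ℝ × ℝ^{d−1} : |ξ₁| ≥ 100|ξ'|}, and let E(t) = e^{itΔ}E₀. Then for every T > 0, ( ∫₀^T ∫_ℝ ( ∫_{ℝ^{d−1}} |∂_tn(t,x₁,y)|² dy ) ( ∫_{ℝ^{d−1}} |E(t,x₁,y)|² dy ) dx₁ dt )^{1/2} ≤ C λ μ^{−1/2} ‖E₀‖_{L²(ℝ^d)} ( ‖n₀‖_{L²(ℝ^d)} + λ^{−1} ‖n₁‖_{L²(ℝ^d)} ). -/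

import Mathlib

open MeasureTheory

noncomputable section

/-- The dot product on `ℝ^d = ℝ × ℝ^{d-1}`. -/
def dotp {k : ℕ} (x ξ : ℝ × (Fin k → ℝ)) : ℝ := x.1 * ξ.1 + ∑ i, x.2 i * ξ.2 i

/-- The squared Euclidean norm on `ℝ^d = ℝ × ℝ^{d-1}`. -/
def nsq {k : ℕ} (ξ : ℝ × (Fin k → ℝ)) : ℝ := ξ.1 ^ 2 + ∑ i, ξ.2 i ^ 2

/-- The Fourier transform `û(ξ) = ∫ e^{-i x·ξ} u(x) dx`. -/
def FT {k : ℕ} (u : (ℝ × (Fin k → ℝ)) → ℂ) (ξ : ℝ × (Fin k → ℝ)) : ℂ :=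
  ∫ x : ℝ × (Fin k → ℝ), Complex.exp (-Complex.I * (dotp x ξ : ℂ)) * u x

/-- The free Schrödinger evolution `e^{itΔ}u₀`. -/
def schrodingerEvol {k : ℕ} (u₀ : (ℝ × (Fin k → ℝ)) → ℂ) (t : ℝ)
    (x : ℝ × (Fin k → ℝ)) : ℂ :=
  ((2 * Real.pi) ^ (k + 1) : ℝ)⁻¹ •
    ∫ ξ : ℝ × (Fin k → ℝ),
      Complex.exp (Complex.I * (dotp x ξ : ℂ) - Complex.I * (t : ℂ) * (nsq ξ : ℂ)) * FT u₀ ξ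

/-- The free wave evolution of data `(n₀, n₁)`, i.e. the function whose spatial Fourier
transform is `cos(t|ξ|) n̂₀(ξ) + (sin(t|ξ|)/|ξ|) n̂₁(ξ)`. -/
def waveEvol {k : ℕ} (n₀ n₁ : (ℝ × (Fin k → ℝ)) → ℂ) (t : ℝ) (x : ℝ × (Fin k → ℝ)) : ℂ :=
  ((2 * Real.pi) ^ (k + 1) : ℝ)⁻¹ •
    ∫ ξ : ℝ × (Fin k → ℝ),
      Complex.exp (Complex.I * (dotp x ξ : ℂ)) *
        ((Real.cos (t * Real.sqrt (nsq ξ)) : ℂ) * FT n₀ ξ +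
         ((Real.sin (t * Real.sqrt (nsq ξ)) / Real.sqrt (nsq ξ) : ℝ) : ℂ) * FT n₁ ξ)

/-- The half-wave evolution `e^{-itΛ}v₀`, `Λ = (-Δ)^{1/2}`, i.e. the function whose spatial
Fourier transform is `e^{-it|ξ|} v̂₀(ξ)`. -/
def halfWaveEvol {k : ℕ} (v₀ : (ℝ × (Fin k → ℝ)) → ℂ) (t : ℝ) (x : ℝ × (Fin k → ℝ)) : ℂ :=
  ((2 * Real.pi) ^ (k + 1) : ℝ)⁻¹ •
    ∫ ξ : ℝ × (Fin k → ℝ),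
      Complex.exp (Complex.I * (dotp x ξ : ℂ) -
        Complex.I * (t : ℂ) * (Real.sqrt (nsq ξ) : ℂ)) * FT v₀ ξ

/-- Membership in the annulus `A_λ = {ξ : 8λ/9 ≤ |ξ| ≤ 9λ/4}`. -/
def inA {k : ℕ} (lam : ℝ) (ξ : ℝ × (Fin k → ℝ)) : Prop :=
  8 * lam / 9 ≤ Real.sqrt (nsq ξ) ∧ Real.sqrt (nsq ξ) ≤ 9 * lam / 4

/-- Membership in the cone `{ξ = (ξ₁, ξ') : |ξ₁| ≥ 100|ξ'|}`. -/
def inCone {k : ℕ} (ξ : ℝ × (Fin k → ℝ)) : Prop :=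
  100 * Real.sqrt (∑ i, ξ.2 i ^ 2) ≤ |ξ.1|

open scoped ENNReal NNReal ComplexConjugate

theorem integral_oscillation_mul_gaussian {ι : Type*} [Fintype ι] {b : ℝ} (hb : 0 < b)
    (v : ι → ℝ) :
    ∫ x : ι → ℝ, Complex.exp (Complex.I * ((∑ i, x i * v i : ℝ) : ℂ)) *
        ((Real.exp (-b * ∑ i, x i ^ 2) : ℝ) : ℂ) =
      (((Real.pi / b) ^ ((Fintype.card ι : ℝ) / 2) *
        Real.exp (-(4 * b)⁻¹ * ∑ i, v i ^ 2) : ℝ) : ℂ) := by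
  have h := GaussianFourier.integral_cexp_neg_mul_sum_add (b := (b : ℂ)) (by simpa using hb)
    (fun i => Complex.I * (v i : ℂ))
  have h1 : (((Real.pi / b) ^ ((Fintype.card ι : ℝ) / 2) *
        Real.exp (-(4 * b)⁻¹ * ∑ i, v i ^ 2) : ℝ) : ℂ) =
      (↑Real.pi / (b : ℂ)) ^ ((Fintype.card ι : ℂ) / 2) *
        Complex.exp ((∑ i, (Complex.I * (v i : ℂ)) ^ 2) / (4 * (b : ℂ))) := by
    rw [Complex.ofReal_mul, Complex.ofReal_cpow (by positivity)]
    congr 1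
    · push_cast; rfl
    · push_cast
      congr 1
      simp only [mul_pow, Complex.I_sq, ← Finset.mul_sum]
      field_simp
  rw [h1, ← h]
  congr 1 with x
  rw [Complex.ofReal_exp, ← Complex.exp_add]
  congr 1
  push_cast
  rw [add_comm (-(b : ℂ) * _), Finset.mul_sum]
  congr 1
  exact Finset.sum_congr rfl fun i _ => by ring

theorem integrable_exp_neg_mul_sum_sq {ι : Type*} [Fintype ι] {b : ℝ} (hb : 0 < b) :
    Integrable fun x : ι → ℝ => Real.exp (-b * ∑ i, x i ^ 2) := by
  have h := GaussianFourier.integrable_cexp_neg_mul_sum_add (b := (b : ℂ)) (by simpa using hb)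
    (fun _ : ι => (0 : ℂ))
  have h2 := h.re
  refine h2.congr (Filter.Eventually.of_forall fun x => ?_)
  simp only [zero_mul, Finset.sum_const_zero, add_zero]
  have : (-(b : ℂ) * ∑ i, (x i : ℂ) ^ 2) = ((-b * ∑ i, x i ^ 2 : ℝ) : ℂ) := by push_cast; rfl
  rw [this, ← Complex.ofReal_exp]
  exact Complex.ofReal_re _

theorem integral_exp_neg_mul_sum_sq {ι : Type*} [Fintype ι] {b : ℝ} (hb : 0 < b) :
    ∫ x : ι → ℝ, Real.exp (-b * ∑ i, x i ^ 2) = (Real.pi / b) ^ ((Fintype.card ι : ℝ) / 2) := by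
  have h := integral_oscillation_mul_gaussian hb (0 : ι → ℝ)
  simp only [Pi.zero_apply, mul_zero, Finset.sum_const_zero, Complex.ofReal_zero, Complex.exp_zero,
    one_mul, ne_eq, OfNat.ofNat_ne_zero, not_false_eq_true, zero_pow, Real.exp_zero,
    mul_one] at h
  rw [integral_complex_ofReal] at h
  exact_mod_cast h

/-- The Fourier transform of `x ↦ exp (-b * |x|²)`. -/
def gaussianKernel {ι : Type*} [Fintype ι] (b : ℝ) (v : ι → ℝ) : ℝ :=
  (Real.pi / b) ^ ((Fintype.card ι : ℝ) / 2) * Real.exp (-(4 * b)⁻¹ * ∑ i, v i ^ 2)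

theorem gaussianKernel_nonneg {ι : Type*} [Fintype ι] {b : ℝ} (hb : 0 < b) (v : ι → ℝ) :
    0 ≤ gaussianKernel b v := by
  unfold gaussianKernel; positivity

theorem continuous_gaussianKernel {ι : Type*} [Fintype ι] (b : ℝ) :
    Continuous (gaussianKernel b : (ι → ℝ) → ℝ) := by
  unfold gaussianKernel; fun_prop

theorem gaussianKernel_sub_comm {ι : Type*} [Fintype ι] (b : ℝ) (u v : ι → ℝ) :
    gaussianKernel b (u - v) = gaussianKernel b (v - u) := by
  unfold gaussianKernel
  simp only [Pi.sub_apply, sub_sq_comm]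

theorem lintegral_gaussianKernel {ι : Type*} [Fintype ι] {b : ℝ} (hb : 0 < b) :
    ∫⁻ v : ι → ℝ, ENNReal.ofReal (gaussianKernel b v) =
      ENNReal.ofReal ((2 * Real.pi) ^ Fintype.card ι) := by
  have hb' : 0 < (4 * b)⁻¹ := by positivity
  rw [← ofReal_integral_eq_lintegral_ofReal]
  · congr 1
    unfold gaussianKernel
    rw [integral_const_mul, integral_exp_neg_mul_sum_sq hb', ← Real.mul_rpow (by positivity)
      (by positivity)]
    have : Real.pi / b * (Real.pi / (4 * b)⁻¹) = (2 * Real.pi) ^ 2 := by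
      field_simp; ring
    rw [this, ← Real.rpow_natCast, ← Real.rpow_natCast, ← Real.rpow_mul (by positivity)]
    congr 1
    push_cast; ring
  · exact (integrable_exp_neg_mul_sum_sq hb').const_mul _
  · exact Filter.Eventually.of_forall (gaussianKernel_nonneg hb)

theorem lintegral_gaussianKernel_map_le {Ω ι : Type*} [Fintype ι] [MeasurableSpace Ω]
    {ν : Measure Ω} {Φ : Ω → ι → ℝ} (hΦ : Measurable Φ) {A : ℝ≥0∞}
    (hA : ν.map Φ ≤ A • volume) {b : ℝ} (hb : 0 < b) (u : ι → ℝ) :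
    ∫⁻ ω, ENNReal.ofReal (gaussianKernel b (u - Φ ω)) ∂ν ≤
      A * ENNReal.ofReal ((2 * Real.pi) ^ Fintype.card ι) := by
  have hm : Measurable fun v : ι → ℝ => ENNReal.ofReal (gaussianKernel b (u - v)) :=
    ((continuous_gaussianKernel b).measurable.comp
      (measurable_const.sub measurable_id)).ennreal_ofReal
  calc ∫⁻ ω, ENNReal.ofReal (gaussianKernel b (u - Φ ω)) ∂ν
      = ∫⁻ v, ENNReal.ofReal (gaussianKernel b (u - v)) ∂(ν.map Φ) := (lintegral_map hm hΦ).symm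
    _ ≤ ∫⁻ v, ENNReal.ofReal (gaussianKernel b (u - v)) ∂(A • volume) := lintegral_mono' hA le_rfl
    _ = A * ∫⁻ v : ι → ℝ, ENNReal.ofReal (gaussianKernel b (u - v)) := by
        rw [lintegral_smul_measure, smul_eq_mul]
    _ = A * ENNReal.ofReal ((2 * Real.pi) ^ Fintype.card ι) := by
        rw [lintegral_sub_left_eq_self (μ := (volume : Measure (ι → ℝ)))
          (fun v => ENNReal.ofReal (gaussianKernel b v)) u, lintegral_gaussianKernel hb]

theorem lintegral_schur_le {Ω : Type*} [MeasurableSpace Ω] {ν : Measure Ω} [SFinite ν]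
    {g : Ω → ℝ≥0∞} (hg : Measurable g) {κ : Ω → Ω → ℝ≥0∞}
    (hκ : Measurable (Function.uncurry κ)) (hsymm : ∀ ω ω', κ ω ω' = κ ω' ω) {B : ℝ≥0∞}
    (hB : ∀ ω, ∫⁻ ω', κ ω ω' ∂ν ≤ B) :
    ∫⁻ z, g z.1 * g z.2 * κ z.1 z.2 ∂(ν.prod ν) ≤ 2 * B * ∫⁻ ω, g ω ^ 2 ∂ν := by
  have hκ' : Measurable fun z : Ω × Ω => κ z.1 z.2 := hκ
  have hm : ∀ a b : ℝ≥0∞, a * b ≤ a ^ 2 + b ^ 2 := fun a b => by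
    rcases le_total a b with h | h
    · exact (mul_le_mul_left h b).trans (by rw [← sq]; exact le_add_self)
    · exact (mul_le_mul_right h a).trans (by rw [← sq]; exact le_self_add)
  have key : ∫⁻ z, g z.1 ^ 2 * κ z.1 z.2 ∂(ν.prod ν) ≤ B * ∫⁻ ω, g ω ^ 2 ∂ν := by
    rw [lintegral_prod _ (by fun_prop)]
    calc ∫⁻ x, ∫⁻ y, g x ^ 2 * κ x y ∂ν ∂ν = ∫⁻ x, g x ^ 2 * ∫⁻ y, κ x y ∂ν ∂ν := by
          congr 1 with x
          exact lintegral_const_mul _ (hκ'.comp measurable_prodMk_left)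
      _ ≤ ∫⁻ x, B * g x ^ 2 ∂ν := by
          refine lintegral_mono fun x => ?_
          rw [mul_comm]
          exact mul_le_mul_left (hB x) _
      _ = B * ∫⁻ x, g x ^ 2 ∂ν := lintegral_const_mul _ (by fun_prop)
  calc ∫⁻ z, g z.1 * g z.2 * κ z.1 z.2 ∂(ν.prod ν)
      ≤ ∫⁻ z, (g z.1 ^ 2 * κ z.1 z.2 + g z.2 ^ 2 * κ z.1 z.2) ∂(ν.prod ν) := by
        refine lintegral_mono fun z => ?_
        rw [← add_mul]
        exact mul_le_mul_left (hm _ _) _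
    _ = ∫⁻ z, g z.1 ^ 2 * κ z.1 z.2 ∂(ν.prod ν) + ∫⁻ z, g z.2 ^ 2 * κ z.1 z.2 ∂(ν.prod ν) :=
        lintegral_add_left (by fun_prop) _
    _ = ∫⁻ z, g z.1 ^ 2 * κ z.1 z.2 ∂(ν.prod ν) + ∫⁻ z, g z.1 ^ 2 * κ z.1 z.2 ∂(ν.prod ν) := by
        congr 1
        rw [← lintegral_prod_swap]
        refine lintegral_congr fun z => ?_
        simp [hsymm z.2 z.1]
    _ ≤ 2 * B * ∫⁻ ω, g ω ^ 2 ∂ν := by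
        rw [mul_assoc, two_mul]
        exact add_le_add key key

theorem norm_exp_I_mul_ofReal' (r : ℝ) : ‖Complex.exp (Complex.I * (r : ℂ))‖ = 1 := by
  rw [mul_comm]; exact Complex.norm_exp_ofReal_mul_I r

/-- Expansion of a weighted `L²` norm of `x ↦ ∫ e x ω * G ω` as a double integral. -/
theorem integral_norm_sq_mul_eq {X Ω : Type*} [MeasurableSpace X] [MeasurableSpace Ω]
    {ρ : Measure X} [SFinite ρ] {ν : Measure Ω} [SFinite ν] {e : X → Ω → ℂ}
    (hem : Measurable (Function.uncurry e)) (hen : ∀ x ω, ‖e x ω‖ = 1) {w : X → ℝ}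
    (hwm : Measurable w) (hwi : Integrable w ρ) {G : Ω → ℂ} (hGm : Measurable G)
    (hG : Integrable G ν) :
    Integrable (fun x => ‖∫ ω, e x ω * G ω ∂ν‖ ^ 2 * w x) ρ ∧
      ((∫ x, ‖∫ ω, e x ω * G ω ∂ν‖ ^ 2 * w x ∂ρ : ℝ) : ℂ) =
        ∫ z, G z.1 * conj (G z.2) * ∫ x, e x z.1 * conj (e x z.2) * (w x : ℂ) ∂ρ ∂(ν.prod ν) := by
  set F : X → ℂ := fun x => ∫ ω, e x ω * G ω ∂ν with hF
  set H : X → Ω × Ω → ℂ := fun x z =>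
    (e x z.1 * G z.1) * conj (e x z.2 * G z.2) * (w x : ℂ) with hH
  have hHm : Measurable (Function.uncurry H) := by
    simp only [hH, Function.uncurry_def]
    have h1 : Measurable fun p : X × Ω × Ω => e p.1 p.2.1 :=
      hem.comp (measurable_fst.prodMk (measurable_fst.comp measurable_snd))
    have h2 : Measurable fun p : X × Ω × Ω => e p.1 p.2.2 :=
      hem.comp (measurable_fst.prodMk (measurable_snd.comp measurable_snd))
    have h3 : Measurable (fun z : ℂ => conj z) := Complex.continuous_conj.measurable
    have h4 : Measurable fun p : X × Ω × Ω => conj (e p.1 p.2.2 * G p.2.2) :=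
      h3.comp (h2.mul (hGm.comp (measurable_snd.comp measurable_snd)))
    exact ((h1.mul (hGm.comp (measurable_fst.comp measurable_snd))).mul h4).mul
      (Complex.measurable_ofReal.comp (hwm.comp measurable_fst))
  have hHi : Integrable (Function.uncurry H) (ρ.prod (ν.prod ν)) := by
    have hd : Integrable (fun p : X × Ω × Ω => w p.1 * (‖G p.2.1‖ * ‖G p.2.2‖))
        (ρ.prod (ν.prod ν)) := hwi.mul_prod (hG.norm.mul_prod hG.norm)
    refine hd.mono hHm.aestronglyMeasurable (Filter.Eventually.of_forall fun p => le_of_eq ?_)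
    simp only [Function.uncurry_def, hH, norm_mul, RCLike.norm_conj, hen, one_mul, norm_norm,
      Complex.norm_real]
    ring
  have hHint : ∀ x, ∫ z, H x z ∂(ν.prod ν) = ((‖F x‖ ^ 2 * w x : ℝ) : ℂ) := fun x => by
    simp only [hH]
    rw [integral_mul_const, integral_prod_mul (fun ω => e x ω * G ω)
      (fun ω => conj (e x ω * G ω)), integral_conj, Complex.mul_conj, Complex.normSq_eq_norm_sq]
    push_cast; rfl
  refine ⟨?_, ?_⟩
  · have := hHi.integral_prod_left.re
    refine this.congr (Filter.Eventually.of_forall fun x => ?_)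
    have h2 : ∫ z, Function.uncurry H (x, z) ∂(ν.prod ν) = ((‖F x‖ ^ 2 * w x : ℝ) : ℂ) := hHint x
    simp only [h2]
    exact Complex.ofReal_re _
  · rw [← integral_complex_ofReal]
    change ∫ x, ((‖F x‖ ^ 2 * w x : ℝ) : ℂ) ∂ρ = _
    simp only [← hHint]
    rw [integral_integral_swap hHi]
    congr 1 with z
    rw [← integral_const_mul]
    congr 1 with x
    simp only [hH, map_mul]
    ring

/-- Bessel-type inequality, with a Gaussian weight in the physical variable. -/
theorem lintegral_oscillatory_gaussian_le {Ω ι : Type*} [Fintype ι] [MeasurableSpace Ω]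
    {ν : Measure Ω} [SFinite ν] {Φ : Ω → ι → ℝ} (hΦ : Measurable Φ) {A : ℝ≥0∞}
    (hA : ν.map Φ ≤ A • volume) {G : Ω → ℂ} (hGm : Measurable G) (hG : Integrable G ν)
    {b : ℝ} (hb : 0 < b) :
    ∫⁻ x : ι → ℝ, ‖∫ ω, Complex.exp (Complex.I * ((∑ i, x i * Φ ω i : ℝ) : ℂ)) * G ω ∂ν‖ₑ ^ 2 *
        ENNReal.ofReal (Real.exp (-b * ∑ i, x i ^ 2)) ≤
      2 * (A * ENNReal.ofReal ((2 * Real.pi) ^ Fintype.card ι)) * ∫⁻ ω, ‖G ω‖ₑ ^ 2 ∂ν := by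
  set e : (ι → ℝ) → Ω → ℂ := fun x ω => Complex.exp (Complex.I * ((∑ i, x i * Φ ω i : ℝ) : ℂ))
    with he
  set w : (ι → ℝ) → ℝ := fun x => Real.exp (-b * ∑ i, x i ^ 2) with hw
  set F : (ι → ℝ) → ℂ := fun x => ∫ ω, e x ω * G ω ∂ν with hF
  have hem : Measurable (Function.uncurry e) := by
    have hΦi : ∀ i, Measurable fun ω => Φ ω i := fun i => (measurable_pi_apply i).comp hΦ
    simp only [he, Function.uncurry_def]
    fun_prop
  have hwm : Measurable w := by simp only [hw]; fun_prop
  have hwi : Integrable w := integrable_exp_neg_mul_sum_sq hb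
  obtain ⟨hFi, hsw'⟩ := integral_norm_sq_mul_eq hem
    (fun x ω => norm_exp_I_mul_ofReal' _) hwm hwi hGm hG
  have hsw : ((∫ x, ‖F x‖ ^ 2 * w x : ℝ) : ℂ) =
      ∫ z, G z.1 * conj (G z.2) * ((gaussianKernel b (Φ z.1 - Φ z.2) : ℝ) : ℂ) ∂(ν.prod ν) := by
    rw [hsw']
    congr 1 with z
    rw [gaussianKernel, ← integral_oscillation_mul_gaussian hb]
    congr 2 with x
    simp only [he, ← Complex.exp_conj, map_mul, Complex.conj_I, Complex.conj_ofReal]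
    rw [← Complex.exp_add]
    congr 2
    simp only [Pi.sub_apply, mul_sub, Finset.sum_sub_distrib, Complex.ofReal_sub]
    ring
  calc ∫⁻ x, ‖F x‖ₑ ^ 2 * ENNReal.ofReal (w x)
      = ∫⁻ x, ENNReal.ofReal (‖F x‖ ^ 2 * w x) := by
        congr 1 with x
        rw [ENNReal.ofReal_mul (by positivity), ENNReal.ofReal_pow (norm_nonneg _),
          ofReal_norm]
    _ = ENNReal.ofReal (∫ x, ‖F x‖ ^ 2 * w x) :=
        (ofReal_integral_eq_lintegral_ofReal hFi
          (Filter.Eventually.of_forall fun x =>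
            mul_nonneg (by positivity) (Real.exp_nonneg _))).symm
    _ = ‖((∫ x, ‖F x‖ ^ 2 * w x : ℝ) : ℂ)‖ₑ := by
        rw [← ofReal_norm, Complex.norm_real, Real.norm_of_nonneg]
        exact integral_nonneg fun x => mul_nonneg (by positivity) (Real.exp_nonneg _)
    _ ≤ ∫⁻ z, ‖G z.1 * conj (G z.2) * ((gaussianKernel b (Φ z.1 - Φ z.2) : ℝ) : ℂ)‖ₑ
          ∂(ν.prod ν) := by
        rw [hsw]; exact enorm_integral_le_lintegral_enorm _
    _ = ∫⁻ z, ‖G z.1‖ₑ * ‖G z.2‖ₑ * ENNReal.ofReal (gaussianKernel b (Φ z.1 - Φ z.2))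
          ∂(ν.prod ν) := by
        congr 1 with z
        rw [enorm_mul, enorm_mul]
        congr 2
        · rw [← ofReal_norm, RCLike.norm_conj, ofReal_norm]
        · rw [← ofReal_norm, Complex.norm_real, Real.norm_of_nonneg (gaussianKernel_nonneg hb _)]
    _ ≤ _ := by
        refine lintegral_schur_le (g := fun ω => ‖G ω‖ₑ)
          (κ := fun ω ω' => ENNReal.ofReal (gaussianKernel b (Φ ω - Φ ω'))) hGm.enorm ?_ ?_ ?_
        · exact ((continuous_gaussianKernel b).measurable.comp
            ((hΦ.comp measurable_fst).sub (hΦ.comp measurable_snd))).ennreal_ofReal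
        · intro ω ω'
          rw [gaussianKernel_sub_comm]
        · exact fun ω => lintegral_gaussianKernel_map_le hΦ hA hb (Φ ω)

/-- Bessel-type inequality: an oscillatory integral whose phase map pushes the frequency measure
to at most `A` times Lebesgue measure is bounded in `L²`. -/
theorem lintegral_oscillatory_le {Ω ι : Type*} [Fintype ι] [MeasurableSpace Ω]
    {ν : Measure Ω} [SFinite ν] {Φ : Ω → ι → ℝ} (hΦ : Measurable Φ) {A : ℝ≥0∞}
    (hA : ν.map Φ ≤ A • volume) {G : Ω → ℂ} (hGm : Measurable G) (hG : Integrable G ν) :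
    ∫⁻ x : ι → ℝ, ‖∫ ω, Complex.exp (Complex.I * ((∑ i, x i * Φ ω i : ℝ) : ℂ)) * G ω ∂ν‖ₑ ^ 2 ≤
      2 * (A * ENNReal.ofReal ((2 * Real.pi) ^ Fintype.card ι)) * ∫⁻ ω, ‖G ω‖ₑ ^ 2 ∂ν := by
  have hΦi : ∀ i, Measurable fun ω => Φ ω i := fun i => (measurable_pi_apply i).comp hΦ
  have hFm : Measurable fun x : ι → ℝ =>
      ∫ ω, Complex.exp (Complex.I * ((∑ i, x i * Φ ω i : ℝ) : ℂ)) * G ω ∂ν := by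
    have : Measurable (Function.uncurry fun (x : ι → ℝ) ω =>
      Complex.exp (Complex.I * ((∑ i, x i * Φ ω i : ℝ) : ℂ)) * G ω) := by
      simp only [Function.uncurry_def]
      fun_prop
    exact this.stronglyMeasurable.integral_prod_right.measurable
  set F : (ι → ℝ) → ℂ := fun x =>
    ∫ ω, Complex.exp (Complex.I * ((∑ i, x i * Φ ω i : ℝ) : ℂ)) * G ω ∂ν with hF
  have hlim : ∀ x : ι → ℝ, Filter.Tendsto (fun n : ℕ => ‖F x‖ₑ ^ 2 *
      ENNReal.ofReal (Real.exp (-(1 / ((n : ℝ) + 1)) * ∑ i, x i ^ 2))) Filter.atTop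
      (nhds (‖F x‖ₑ ^ 2)) := by
    intro x
    have h1 : Filter.Tendsto (fun n : ℕ => Real.exp (-(1 / ((n : ℝ) + 1)) * ∑ i, x i ^ 2))
        Filter.atTop (nhds 1) := by
      have := (tendsto_one_div_add_atTop_nhds_zero_nat (𝕜 := ℝ)).neg.mul_const (∑ i, x i ^ 2)
      simp only [neg_zero, zero_mul] at this
      simpa using this.rexp
    have h2 := ENNReal.tendsto_ofReal h1
    rw [ENNReal.ofReal_one] at h2
    have h3 := ENNReal.Tendsto.const_mul (a := ‖F x‖ₑ ^ 2) h2 (Or.inl one_ne_zero)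
    rwa [mul_one] at h3
  calc ∫⁻ x, ‖F x‖ₑ ^ 2
      = ∫⁻ x, Filter.liminf (fun n : ℕ => ‖F x‖ₑ ^ 2 *
          ENNReal.ofReal (Real.exp (-(1 / ((n : ℝ) + 1)) * ∑ i, x i ^ 2))) Filter.atTop := by
        congr 1 with x
        exact (hlim x).liminf_eq.symm
    _ ≤ Filter.liminf (fun n : ℕ => ∫⁻ x, ‖F x‖ₑ ^ 2 *
          ENNReal.ofReal (Real.exp (-(1 / ((n : ℝ) + 1)) * ∑ i, x i ^ 2))) Filter.atTop :=
        lintegral_liminf_le fun n => by fun_prop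
    _ ≤ _ := by
        refine Filter.liminf_le_of_le (by isBoundedDefault) fun c hc => ?_
        obtain ⟨n, hn⟩ := hc.exists
        exact hn.trans (lintegral_oscillatory_gaussian_le hΦ hA hGm hG (by positivity))
theorem lintegral_oscillatory_equiv_le {Ω ι X : Type*} [Fintype ι] [MeasurableSpace Ω]
    [MeasureSpace X] {ν : Measure Ω} [SFinite ν] (e : X ≃ᵐ (ι → ℝ))
    (he : MeasurePreserving e volume volume) {Φ : Ω → X} (hΦ : Measurable Φ) {A : ℝ≥0∞}
    (hA : ν.map Φ ≤ A • volume) {G : Ω → ℂ} (hGm : Measurable G) (hG : Integrable G ν) :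
    ∫⁻ x : X, ‖∫ ω, Complex.exp (Complex.I * ((∑ i, e x i * e (Φ ω) i : ℝ) : ℂ)) * G ω ∂ν‖ₑ ^ 2 ≤
      2 * (A * ENNReal.ofReal ((2 * Real.pi) ^ Fintype.card ι)) * ∫⁻ ω, ‖G ω‖ₑ ^ 2 ∂ν := by
  have hA' : ν.map (fun ω => e (Φ ω)) ≤ A • volume := by
    have h1 : ν.map (fun ω => e (Φ ω)) = (ν.map Φ).map e :=
      (Measure.map_map e.measurable hΦ).symm
    rw [h1, ← he.map_eq, ← Measure.map_smul]
    exact Measure.map_mono hA e.measurable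
  rw [he.lintegral_comp_emb e.measurableEmbedding (fun x =>
    ‖∫ ω, Complex.exp (Complex.I * ((∑ i, x i * e (Φ ω) i : ℝ) : ℂ)) * G ω ∂ν‖ₑ ^ 2)]
  exact lintegral_oscillatory_le (e.measurable.comp hΦ) hA' hGm hG

theorem exists_coordinates_prod (k : ℕ) :
    ∃ e : (ℝ × (Fin k → ℝ)) ≃ᵐ (Unit ⊕ Fin k → ℝ), MeasurePreserving e volume volume ∧
      ∀ x v, ∑ i, e x i * e v i = dotp x v := by
  refine ⟨((MeasurableEquiv.funUnique Unit ℝ).symm.prodCongr (MeasurableEquiv.refl _)).trans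
    (MeasurableEquiv.sumPiEquivProdPi (fun _ : Unit ⊕ Fin k => ℝ)).symm, ?_, fun x v => ?_⟩
  · exact (volume_measurePreserving_sumPiEquivProdPi_symm (fun _ : Unit ⊕ Fin k => ℝ)).comp
      (((volume_preserving_funUnique Unit ℝ).symm _).prod (MeasurePreserving.id _))
  · rw [Fintype.sum_sum_type]
    simp [dotp]
    rfl

theorem exists_coordinates_prod_prod (k : ℕ) :
    ∃ e : ((ℝ × (Fin k → ℝ)) × (ℝ × (Fin k → ℝ))) ≃ᵐ
        ((Unit ⊕ Fin k) ⊕ (Unit ⊕ Fin k) → ℝ), MeasurePreserving e volume volume ∧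
      ∀ x v, ∑ i, e x i * e v i = dotp x.1 v.1 + dotp x.2 v.2 := by
  obtain ⟨e, he, hd⟩ := exists_coordinates_prod k
  refine ⟨(e.prodCongr e).trans
    (MeasurableEquiv.sumPiEquivProdPi (fun _ : (Unit ⊕ Fin k) ⊕ (Unit ⊕ Fin k) => ℝ)).symm,
    ?_, fun x v => ?_⟩
  · exact (volume_measurePreserving_sumPiEquivProdPi_symm
      (fun _ : (Unit ⊕ Fin k) ⊕ (Unit ⊕ Fin k) => ℝ)).comp (he.prod he)
  · rw [Fintype.sum_sum_type, ← hd, ← hd]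
    rfl

/-- Plancherel inequality for `FT`, up to a constant. -/
theorem lintegral_FT_sq_le {k : ℕ} {u : ℝ × (Fin k → ℝ) → ℂ} (hum : Measurable u)
    (hu : Integrable u) :
    ∫⁻ ξ, ‖FT u ξ‖ₑ ^ 2 ≤
      2 * ENNReal.ofReal ((2 * Real.pi) ^ (k + 1)) * ∫⁻ x, ‖u x‖ₑ ^ 2 := by
  obtain ⟨e, he, hd⟩ := exists_coordinates_prod k
  have h := lintegral_oscillatory_equiv_le (ν := volume) e he
    (Φ := fun x : ℝ × (Fin k → ℝ) => -x) measurable_neg (A := 1)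
    (by
        rw [one_smul]
        exact ((Measure.measurePreserving_neg (volume : Measure ℝ)).prod
          (Measure.measurePreserving_neg (volume : Measure (Fin k → ℝ)))).map_eq.le) hum hu
  simp only [hd, one_mul, Fintype.card_sum, Fintype.card_unit, Fintype.card_fin] at h
  rw [add_comm 1 k] at h
  refine le_trans (le_of_eq ?_) h
  congr 1 with ξ
  unfold FT
  congr 4 with x
  congr 2
  simp only [dotp, Prod.fst_neg, Prod.snd_neg, Pi.neg_apply, mul_neg, Finset.sum_neg_distrib]
  rw [← neg_add, Complex.ofReal_neg, mul_neg, neg_mul]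
  simp only [mul_comm]

theorem lintegral_prod_prod_eq {α β γ δ : Type*} [MeasureSpace α] [MeasureSpace β]
    [MeasureSpace γ] [MeasureSpace δ] [SFinite (volume : Measure α)]
    [SFinite (volume : Measure β)] [SFinite (volume : Measure γ)] [SFinite (volume : Measure δ)]
    {f : (α × β) × (γ × δ) → ℝ≥0∞} (hf : Measurable f) :
    ∫⁻ q, f q = ∫⁻ c, ∫⁻ a, ∫⁻ d, ∫⁻ b, f ((a, b), (c, d)) := by
  rw [Measure.volume_eq_prod, lintegral_prod_symm _ hf.aemeasurable, Measure.volume_eq_prod γ δ,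
    lintegral_prod _ (by fun_prop)]
  congr 1 with c
  calc ∫⁻ d, ∫⁻ x : α × β, f (x, (c, d)) = ∫⁻ d, ∫⁻ a, ∫⁻ b, f ((a, b), (c, d)) := by
        congr 1 with d
        rw [Measure.volume_eq_prod α β, lintegral_prod _ (by fun_prop)]
    _ = _ := lintegral_lintegral_swap (by fun_prop)

theorem lintegral_mul_lintegral_eq {α β γ δ : Type*} [MeasureSpace α] [MeasureSpace β]
    [MeasureSpace γ] [MeasureSpace δ] [SFinite (volume : Measure α)]
    [SFinite (volume : Measure β)] [SFinite (volume : Measure γ)] [SFinite (volume : Measure δ)]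
    {f : γ × α × β → ℝ≥0∞} (hf : Measurable f) {g : γ × α × δ → ℝ≥0∞} (hg : Measurable g) :
    ∫⁻ c, ∫⁻ a, (∫⁻ b, f (c, a, b)) * ∫⁻ d, g (c, a, d) =
      ∫⁻ q : (α × β) × (γ × δ), f (q.2.1, q.1.1, q.1.2) * g (q.2.1, q.1.1, q.2.2) := by
  rw [lintegral_prod_prod_eq (by fun_prop)]
  congr 1 with c
  congr 1 with a
  rw [← lintegral_const_mul _ (by fun_prop)]
  congr 1 with d
  exact (lintegral_mul_const _ (by fun_prop)).symm

/-- The evolution with symbol `h` and Fourier-side datum `a`, without normalisation. -/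
def oscillatoryEvol {k : ℕ} (h : ℝ × (Fin k → ℝ) → ℝ) (a : ℝ × (Fin k → ℝ) → ℂ) (t : ℝ)
    (x : ℝ × (Fin k → ℝ)) : ℂ :=
  ∫ ξ, Complex.exp (Complex.I * ((dotp x ξ + t * h ξ : ℝ) : ℂ)) * a ξ

theorem measurable_oscillatoryEvol {k : ℕ} {h : ℝ × (Fin k → ℝ) → ℝ} (hh : Measurable h)
    {a : ℝ × (Fin k → ℝ) → ℂ} (ha : Measurable a) :
    Measurable fun p : ℝ × ℝ × (Fin k → ℝ) => oscillatoryEvol h a p.1 p.2 := by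
  have : Measurable (Function.uncurry fun (p : ℝ × ℝ × (Fin k → ℝ)) (ξ : ℝ × (Fin k → ℝ)) =>
      Complex.exp (Complex.I * ((dotp p.2 ξ + p.1 * h ξ : ℝ) : ℂ)) * a ξ) := by
    simp only [Function.uncurry_def]
    unfold dotp
    fun_prop
  exact this.stronglyMeasurable.integral_prod_right.measurable

/-- Bilinear estimate in terms of the push-forward of the frequency measure. -/
theorem lintegral_bilinear_le {k : ℕ} {h₁ h₂ : ℝ × (Fin k → ℝ) → ℝ} (hh₁ : Measurable h₁)
    (hh₂ : Measurable h₂) {a b : ℝ × (Fin k → ℝ) → ℂ} (ham : Measurable a) (hai : Integrable a)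
    (hbm : Measurable b) (hbi : Integrable b) {S : Set (ℝ × (Fin k → ℝ))}
    (hS : ∀ ξ, ξ ∉ S → b ξ = 0) {A : ℝ≥0∞}
    (hA : (volume.prod (volume.restrict S)).map
      (fun p : (ℝ × (Fin k → ℝ)) × (ℝ × (Fin k → ℝ)) =>
        (((p.2.1 + p.1.1, p.1.2), (h₁ p.1 + h₂ p.2, p.2.2)) :
          (ℝ × (Fin k → ℝ)) × (ℝ × (Fin k → ℝ)))) ≤ A • volume) :
    ∫⁻ t, ∫⁻ x, (∫⁻ y : Fin k → ℝ, ‖oscillatoryEvol h₁ a t (x, y)‖ₑ ^ 2) *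
        (∫⁻ y : Fin k → ℝ, ‖oscillatoryEvol h₂ b t (x, y)‖ₑ ^ 2) ≤
      2 * (A * ENNReal.ofReal ((2 * Real.pi) ^ (2 * (k + 1)))) *
        ((∫⁻ ξ, ‖a ξ‖ₑ ^ 2) * ∫⁻ ξ, ‖b ξ‖ₑ ^ 2) := by
  obtain ⟨e, he, hd⟩ := exists_coordinates_prod_prod k
  have hbS : Function.support b ⊆ S := fun ξ hξ => by_contra fun h => hξ (hS ξ h)
  have hm := lintegral_oscillatory_equiv_le e he (by fun_prop) hA
    (G := fun p => a p.1 * b p.2) (by fun_prop) (hai.mul_prod hbi.restrict)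
  rw [lintegral_mul_lintegral_eq
    (f := fun p => ‖oscillatoryEvol h₁ a p.1 p.2‖ₑ ^ 2)
    (g := fun p => ‖oscillatoryEvol h₂ b p.1 p.2‖ₑ ^ 2)
    ((measurable_oscillatoryEvol hh₁ ham).enorm.pow_const 2)
    ((measurable_oscillatoryEvol hh₂ hbm).enorm.pow_const 2)]
  have hcard : Fintype.card ((Unit ⊕ Fin k) ⊕ (Unit ⊕ Fin k)) = 2 * (k + 1) := by
    simp; ring
  rw [hcard] at hm
  refine le_trans (le_of_eq ?_) (hm.trans (le_of_eq ?_))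
  · congr 1 with q
    rw [← mul_pow, ← enorm_mul]
    congr 2
    have hb' : oscillatoryEvol h₂ b q.2.1 (q.1.1, q.2.2) = ∫ ξ in S,
        Complex.exp (Complex.I * ((dotp (q.1.1, q.2.2) ξ + q.2.1 * h₂ ξ : ℝ) : ℂ)) * b ξ := by
      rw [setIntegral_eq_integral_of_forall_compl_eq_zero]
      · rfl
      · intro ξ hξ
        rw [hS ξ hξ, mul_zero]
    rw [hb', oscillatoryEvol, ← integral_prod_mul]
    congr 1 with p
    rw [hd, mul_mul_mul_comm, ← Complex.exp_add, ← mul_add, ← Complex.ofReal_add]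
    congr 4
    simp only [dotp]
    ring
  · congr 1
    have : ∫⁻ ξ, ‖b ξ‖ₑ ^ 2 = ∫⁻ ξ in S, ‖b ξ‖ₑ ^ 2 := by
      rw [setLIntegral_eq_of_support_subset]
      intro ξ hξ
      refine hbS fun h => hξ ?_
      simp [h]
    rw [this, ← lintegral_prod_mul (by fun_prop) (by fun_prop)]
    congr 1 with p
    rw [enorm_mul, mul_pow]

theorem setLIntegral_comp_le_of_expanding {S : Set ℝ} {m : ℝ → ℝ}
    (hm : Measurable m) {r : ℝ} (hr : 0 < r)
    (hexp : ∀ s ∈ S, ∀ t ∈ S, r * |s - t| ≤ |m s - m t|) {φ : ℝ → ℝ≥0∞} (hφ : Measurable φ) :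
    ∫⁻ s in S, φ (m s) ≤ ENNReal.ofReal r⁻¹ * ∫⁻ b, φ b := by
  have hmeas : (volume.restrict S).map m ≤ ENNReal.ofReal r⁻¹ • volume := by
    refine Measure.le_iff.2 fun B hB => ?_
    rw [Measure.map_apply hm hB, Measure.restrict_apply (hm hB), Measure.smul_apply, smul_eq_mul]
    have hinj : Set.InjOn m S := fun s hs t ht hst => by
      have h := hexp s hs t ht
      rw [hst, sub_self, abs_zero] at h
      have : |s - t| ≤ 0 := nonpos_of_mul_nonpos_right h hr
      exact sub_eq_zero.1 (abs_nonpos_iff.1 this)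
    have hleft := hinj.leftInvOn_invFunOn
    have hlip : LipschitzOnWith (Real.toNNReal r⁻¹) (Function.invFunOn m S) (m '' S) := by
      refine LipschitzOnWith.of_dist_le_mul ?_
      rintro _ ⟨s, hs, rfl⟩ _ ⟨t, ht, rfl⟩
      rw [hleft hs, hleft ht, Real.coe_toNNReal _ (by positivity), Real.dist_eq, Real.dist_eq,
        le_inv_mul_iff₀ hr]
      exact hexp s hs t ht
    have hsub : m ⁻¹' B ∩ S ⊆ Function.invFunOn m S '' (B ∩ m '' S) := fun s hs =>
      ⟨m s, ⟨hs.1, s, hs.2, rfl⟩, hleft hs.2⟩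
    have hH := (hlip.mono (Set.inter_subset_right (s := B))).hausdorffMeasure_image_le
      zero_le_one
    rw [hausdorffMeasure_real, ENNReal.rpow_one] at hH
    exact (measure_mono hsub).trans (hH.trans
      (mul_le_mul_right (measure_mono Set.inter_subset_left) _))
  calc ∫⁻ s in S, φ (m s) = ∫⁻ b, φ b ∂((volume.restrict S).map m) := (lintegral_map hφ hm).symm
    _ ≤ ∫⁻ b, φ b ∂(ENNReal.ofReal r⁻¹ • volume) := lintegral_mono' hmeas le_rfl
    _ = _ := by rw [lintegral_smul_measure, smul_eq_mul]

theorem abs_sqrt_sq_add_sub_le {q : ℝ} (hq : 0 ≤ q) (x y : ℝ) :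
    |Real.sqrt (x ^ 2 + q) - Real.sqrt (y ^ 2 + q)| ≤ |x - y| := by
  have key : ∀ x y : ℝ, Real.sqrt (x ^ 2 + q) ≤ Real.sqrt (y ^ 2 + q) + |x - y| := fun x y => by
    refine Real.sqrt_le_iff.2 ⟨by positivity, ?_⟩
    have h1 : |y| ≤ Real.sqrt (y ^ 2 + q) := Real.abs_le_sqrt (by linarith)
    have h2 := Real.sq_sqrt (show 0 ≤ y ^ 2 + q by positivity)
    have h3 : y * (x - y) ≤ |y| * |x - y| := by rw [← abs_mul]; exact le_abs_self _
    have h4 := mul_le_mul_of_nonneg_right h1 (abs_nonneg (x - y))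
    nlinarith [sq_abs (x - y)]
  refine abs_sub_le_iff.2 ⟨by linarith [key x y], ?_⟩
  have := key y x
  rw [abs_sub_comm] at this
  linarith

/-- Transversality of the paraboloid and the light cone in the first frequency variable. -/
theorem expanding_phase {σ r a p q : ℝ} (hσ : |σ| ≤ 1) (hr : 1 ≤ r) (hq : 0 ≤ q) {s t : ℝ}
    (h : 2 * r ≤ |s + t|) :
    r * |s - t| ≤ |(σ * Real.sqrt ((a - s) ^ 2 + q) + -(s ^ 2 + p)) -
      (σ * Real.sqrt ((a - t) ^ 2 + q) + -(t ^ 2 + p))| := by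
  have h1 := abs_sqrt_sq_add_sub_le hq (a - s) (a - t)
  have h2 : |σ * (Real.sqrt ((a - s) ^ 2 + q) - Real.sqrt ((a - t) ^ 2 + q))| ≤ |s - t| := by
    rw [abs_mul]
    have : |a - s - (a - t)| = |s - t| := by rw [abs_sub_comm]; congr 1; ring
    rw [this] at h1
    nlinarith [abs_nonneg (s - t), abs_nonneg σ,
      abs_nonneg (Real.sqrt ((a - s) ^ 2 + q) - Real.sqrt ((a - t) ^ 2 + q))]
  have h3 : 2 * r * |s - t| ≤ |s ^ 2 - t ^ 2| := by
    have : s ^ 2 - t ^ 2 = (s + t) * (s - t) := by ring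
    rw [this, abs_mul]
    exact mul_le_mul_of_nonneg_right h (abs_nonneg _)
  have h4 := abs_sub_abs_le_abs_sub (s ^ 2 - t ^ 2)
    (σ * (Real.sqrt ((a - s) ^ 2 + q) - Real.sqrt ((a - t) ^ 2 + q)))
  have h5 : (σ * Real.sqrt ((a - s) ^ 2 + q) + -(s ^ 2 + p)) -
      (σ * Real.sqrt ((a - t) ^ 2 + q) + -(t ^ 2 + p)) = -((s ^ 2 - t ^ 2) -
      (σ * (Real.sqrt ((a - s) ^ 2 + q) - Real.sqrt ((a - t) ^ 2 + q)))) := by ring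
  rw [h5, abs_neg]
  nlinarith [abs_nonneg (s - t)]

theorem setLIntegral_phase_le {σ r a p q : ℝ} (hσ : |σ| ≤ 1) (hr : 1 ≤ r) (hq : 0 ≤ q)
    {φ : ℝ → ℝ≥0∞} (hφ : Measurable φ) :
    ∫⁻ s in {s : ℝ | r ≤ |s|}, φ (σ * Real.sqrt ((a - s) ^ 2 + q) + -(s ^ 2 + p)) ≤
      2 * ENNReal.ofReal r⁻¹ * ∫⁻ b, φ b := by
  have hset : {s : ℝ | r ≤ |s|} ⊆ Set.Ici r ∪ Set.Iic (-r) := fun s hs => by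
    rcases le_abs.1 (show r ≤ |s| from hs) with h | h
    · exact Or.inl h
    · exact Or.inr (by simp only [Set.mem_Iic]; linarith)
  have hm : Measurable fun s : ℝ => σ * Real.sqrt ((a - s) ^ 2 + q) + -(s ^ 2 + p) := by fun_prop
  have hr0 : 0 < r := by linarith
  refine (lintegral_mono_set hset).trans ((lintegral_union_le _ _ _).trans ?_)
  rw [mul_assoc, two_mul]
  refine add_le_add
    (setLIntegral_comp_le_of_expanding hm hr0 (fun s hs t ht => ?_) hφ)
    (setLIntegral_comp_le_of_expanding hm hr0 (fun s hs t ht => ?_) hφ)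
  · refine expanding_phase hσ hr hq (le_abs.2 (Or.inl ?_))
    linarith [Set.mem_Ici.1 hs, Set.mem_Ici.1 ht]
  · refine expanding_phase hσ hr hq (le_abs.2 (Or.inr ?_))
    linarith [Set.mem_Iic.1 hs, Set.mem_Iic.1 ht]

theorem lintegral_lintegral_shear {f : ℝ → ℝ → ℝ≥0∞} (hf : Measurable (Function.uncurry f)) :
    ∫⁻ s, ∫⁻ x, f s x = ∫⁻ a, ∫⁻ s, f s (a - s) := by
  have hf' : Measurable fun p : ℝ × ℝ => f p.1 p.2 := hf
  calc ∫⁻ s, ∫⁻ x, f s x = ∫⁻ s, ∫⁻ a, f s (a - s) := by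
        congr 1 with s
        exact (lintegral_sub_right_eq_self (fun x => f s x) s).symm
    _ = _ := lintegral_lintegral_swap (by
        exact (hf'.comp (measurable_fst.prodMk (measurable_snd.sub measurable_fst))).aemeasurable)

theorem lintegral_prod_prod_eq_symm {α β γ δ : Type*} [MeasureSpace α] [MeasureSpace β]
    [MeasureSpace γ] [MeasureSpace δ] [SFinite (volume : Measure α)]
    [SFinite (volume : Measure β)] [SFinite (volume : Measure γ)] [SFinite (volume : Measure δ)]
    {f : (α × β) × (γ × δ) → ℝ≥0∞} (hf : Measurable f) :
    ∫⁻ q, f q = ∫⁻ d, ∫⁻ b, ∫⁻ c, ∫⁻ a, f ((a, b), (c, d)) := by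
  rw [Measure.volume_eq_prod, lintegral_prod_symm _ hf.aemeasurable, Measure.volume_eq_prod γ δ,
    lintegral_prod_symm _ (Measurable.aemeasurable (by fun_prop))]
  congr 1 with d
  calc ∫⁻ c, ∫⁻ x : α × β, f (x, (c, d)) = ∫⁻ c, ∫⁻ b, ∫⁻ a, f ((a, b), (c, d)) := by
        congr 1 with c
        rw [Measure.volume_eq_prod α β,
          lintegral_prod_symm _ (Measurable.aemeasurable (by fun_prop))]
    _ = _ := lintegral_lintegral_swap (by fun_prop)

theorem map_frequency_le {k : ℕ} {σ r : ℝ} (hσ : |σ| ≤ 1) (hr : 1 ≤ r)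
    {S : Set (ℝ × (Fin k → ℝ))} (hSm : MeasurableSet S) (hS : ∀ ξ ∈ S, r ≤ |ξ.1|) :
    (volume.prod (volume.restrict S)).map
      (fun p : (ℝ × (Fin k → ℝ)) × (ℝ × (Fin k → ℝ)) =>
        (((p.2.1 + p.1.1, p.1.2), (σ * Real.sqrt (nsq p.1) + -nsq p.2, p.2.2)) :
          (ℝ × (Fin k → ℝ)) × (ℝ × (Fin k → ℝ)))) ≤ (2 * ENNReal.ofReal r⁻¹) • volume := by
  set Φ := (fun p : (ℝ × (Fin k → ℝ)) × (ℝ × (Fin k → ℝ)) =>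
        (((p.2.1 + p.1.1, p.1.2), (σ * Real.sqrt (nsq p.1) + -nsq p.2, p.2.2)) :
          (ℝ × (Fin k → ℝ)) × (ℝ × (Fin k → ℝ)))) with hΦ
  have hΦm : Measurable Φ := by
    simp only [hΦ, nsq]
    fun_prop
  have hRm : MeasurableSet {s : ℝ | r ≤ |s|} := measurableSet_le measurable_const (by fun_prop)
  refine Measure.le_iff.2 fun B hB => ?_
  rw [Measure.map_apply hΦm hB, Measure.smul_apply, smul_eq_mul, ← lintegral_indicator_one hB,
    ← lintegral_indicator_one (hΦm hB)]
  set φ : (ℝ × (Fin k → ℝ)) × (ℝ × (Fin k → ℝ)) → ℝ≥0∞ := B.indicator 1 with hφ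
  have hφm : Measurable φ := measurable_one.indicator hB
  set u : ℝ → ℝ≥0∞ := {s : ℝ | r ≤ |s|}.indicator 1 with hu
  have hum : Measurable u := measurable_one.indicator hRm
  have hSu : ∀ ξ : ℝ × (Fin k → ℝ),
      S.indicator (1 : ℝ × (Fin k → ℝ) → ℝ≥0∞) ξ ≤ u ξ.1 := fun ξ => by
    by_cases hξ : ξ ∈ S
    · rw [hu, Set.indicator_of_mem hξ,
        Set.indicator_of_mem (show ξ.1 ∈ {s : ℝ | r ≤ |s|} from hS ξ hξ)]
      simp
    · rw [Set.indicator_of_notMem hξ]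
      exact zero_le
  have hprod : (volume : Measure (ℝ × (Fin k → ℝ))).prod (volume.restrict S) =
      (volume.prod volume).restrict (Set.univ ×ˢ S) := by
    rw [← Measure.prod_restrict, Measure.restrict_univ]
  calc ∫⁻ p, (Φ ⁻¹' B).indicator 1 p ∂(volume.prod (volume.restrict S))
      = ∫⁻ p, (Set.univ ×ˢ S).indicator (fun p => φ (Φ p)) p := by
        rw [hprod, lintegral_indicator (MeasurableSet.univ.prod hSm)]
        rfl
    _ ≤ ∫⁻ p : (ℝ × (Fin k → ℝ)) × (ℝ × (Fin k → ℝ)), u p.2.1 * φ (Φ p) := by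
        refine lintegral_mono fun p => ?_
        by_cases hp : p.2 ∈ S
        · have h1 := hSu p.2
          rw [Set.indicator_of_mem hp] at h1
          rw [Set.indicator_of_mem (by exact ⟨trivial, hp⟩)]
          exact le_mul_of_one_le_left zero_le h1
        · rw [Set.indicator_of_notMem (fun h => hp h.2)]
          exact zero_le
    _ = ∫⁻ z : Fin k → ℝ, ∫⁻ y : Fin k → ℝ, ∫⁻ s : ℝ, ∫⁻ x : ℝ, u s * φ (Φ ((x, y), (s, z))) := by
        exact lintegral_prod_prod_eq_symm (by fun_prop)
    _ = ∫⁻ z : Fin k → ℝ, ∫⁻ y : Fin k → ℝ, ∫⁻ a : ℝ, ∫⁻ s : ℝ,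
          u s * φ (Φ ((a - s, y), (s, z))) := by
        congr 1 with z
        congr 1 with y
        refine lintegral_lintegral_shear (f := fun s x => u s * φ (Φ ((x, y), (s, z)))) ?_
        simp only [Function.uncurry_def]
        fun_prop
    _ ≤ ∫⁻ z : Fin k → ℝ, ∫⁻ y : Fin k → ℝ, ∫⁻ a : ℝ,
          2 * ENNReal.ofReal r⁻¹ * ∫⁻ b : ℝ, φ ((a, y), (b, z)) := by
        refine lintegral_mono fun z => lintegral_mono fun y => lintegral_mono fun a => ?_
        refine le_trans (le_of_eq ?_) (setLIntegral_phase_le (a := a) (p := ∑ i, z i ^ 2)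
          (q := ∑ i, y i ^ 2) hσ hr (Finset.sum_nonneg fun i _ => sq_nonneg _)
          (φ := fun b => φ ((a, y), (b, z))) (by fun_prop))
        rw [← lintegral_indicator hRm]
        congr 1 with s
        by_cases hs : s ∈ {s : ℝ | r ≤ |s|}
        · rw [hu, Set.indicator_of_mem hs, Set.indicator_of_mem hs]
          simp [hΦ, nsq]
        · rw [hu, Set.indicator_of_notMem hs, Set.indicator_of_notMem hs, zero_mul]
    _ = 2 * ENNReal.ofReal r⁻¹ * ∫⁻ q, φ q := by
        rw [← lintegral_const_mul _ hφm, lintegral_prod_prod_eq_symm (by fun_prop)]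
        congr 1 with z
        congr 1 with y
        rw [lintegral_lintegral_swap (by fun_prop)]
        congr 1 with a
        exact (lintegral_const_mul _ (by fun_prop)).symm
theorem continuous_FT {k : ℕ} {u : ℝ × (Fin k → ℝ) → ℂ} (hu : Integrable u) :
    Continuous (FT u) := by
  have hn : ∀ x ξ : ℝ × (Fin k → ℝ), ‖Complex.exp (-Complex.I * (dotp x ξ : ℂ)) * u x‖ = ‖u x‖ :=
    fun x ξ => by
      rw [norm_mul, neg_mul, ← mul_neg, ← Complex.ofReal_neg, norm_exp_I_mul_ofReal', one_mul]
  refine continuous_of_dominated (bound := fun x => ‖u x‖) (fun ξ => ?_)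
    (fun ξ => Filter.Eventually.of_forall fun x => (hn x ξ).le) hu.norm
    (Filter.Eventually.of_forall fun x => ?_)
  · refine AEStronglyMeasurable.mul (Continuous.aestronglyMeasurable ?_) hu.aestronglyMeasurable
    unfold dotp; fun_prop
  · unfold dotp; fun_prop

theorem norm_le_sqrt_nsq {k : ℕ} (ξ : ℝ × (Fin k → ℝ)) : ‖ξ‖ ≤ Real.sqrt (nsq ξ) := by
  have hs : ∀ i, ξ.2 i ^ 2 ≤ ∑ j, ξ.2 j ^ 2 := fun i =>
    Finset.single_le_sum (f := fun j => ξ.2 j ^ 2) (fun j _ => sq_nonneg _) (Finset.mem_univ i)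
  have h0 : 0 ≤ ∑ j, ξ.2 j ^ 2 := Finset.sum_nonneg fun j _ => sq_nonneg _
  refine norm_prod_le_iff.2 ⟨Real.abs_le_sqrt ?_, (pi_norm_le_iff_of_nonneg (Real.sqrt_nonneg _)).2
    fun i => Real.abs_le_sqrt ?_⟩
  · unfold nsq; linarith
  · unfold nsq; linarith [hs i, sq_nonneg ξ.1]

theorem integrable_of_annulus {k : ℕ} {lam : ℝ} {f : ℝ × (Fin k → ℝ) → ℂ} (hf : Continuous f)
    (hsupp : ∀ ξ, ¬ inA lam ξ → f ξ = 0) : Integrable f := by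
  have h1 : IntegrableOn f (Metric.closedBall 0 (9 * lam / 4)) :=
    hf.continuousOn.integrableOn_compact (isCompact_closedBall _ _)
  refine (integrableOn_iff_integrable_of_support_subset fun ξ hξ => ?_).1 h1
  have hA : inA lam ξ := by_contra fun h => hξ (hsupp ξ h)
  exact mem_closedBall_zero_iff.2 ((norm_le_sqrt_nsq ξ).trans hA.2)

theorem continuous_nsq {k : ℕ} : Continuous (nsq : ℝ × (Fin k → ℝ) → ℝ) := by
  unfold nsq; fun_prop

theorem half_le_abs_fst {k : ℕ} {mu : ℝ} (hmu : 0 ≤ mu) {ξ : ℝ × (Fin k → ℝ)} (hA : inA mu ξ)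
    (hC : inCone ξ) : mu / 2 ≤ |ξ.1| := by
  have h0 : 0 ≤ ∑ i, ξ.2 i ^ 2 := Finset.sum_nonneg fun i _ => sq_nonneg _
  have h1 : (8 * mu / 9) ^ 2 ≤ nsq ξ := by
    have hn : 0 ≤ nsq ξ := by unfold nsq; positivity
    rw [← Real.sq_sqrt hn]
    exact pow_le_pow_left₀ (by positivity) hA.1 2
  have h2 : 100 ^ 2 * ∑ i, ξ.2 i ^ 2 ≤ ξ.1 ^ 2 := by
    rw [← Real.sq_sqrt h0, ← mul_pow, ← sq_abs ξ.1]
    exact pow_le_pow_left₀ (by positivity) hC 2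
  refine abs_le_of_sq_le_sq' ?_ (abs_nonneg _) |>.2
  rw [sq_abs]
  unfold nsq at h1
  nlinarith [sq_nonneg mu]

theorem schrodingerEvol_eq {k : ℕ} (u : ℝ × (Fin k → ℝ) → ℂ) (t : ℝ) (x : ℝ × (Fin k → ℝ)) :
    schrodingerEvol u t x =
      ((2 * Real.pi) ^ (k + 1) : ℝ)⁻¹ • oscillatoryEvol (fun ξ => -nsq ξ) (FT u) t x := by
  unfold schrodingerEvol oscillatoryEvol
  congr 3 with ξ
  congr 2
  push_cast
  ring

/-- The Fourier-side datum of the half-wave component of `∂ₜ n` with sign `σ`. -/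
def halfWaveDatum {k : ℕ} (n₀ n₁ : ℝ × (Fin k → ℝ) → ℂ) (σ : ℝ) (ξ : ℝ × (Fin k → ℝ)) : ℂ :=
  (FT n₁ ξ + (σ : ℂ) * Complex.I * (Real.sqrt (nsq ξ) : ℂ) * FT n₀ ξ) / 2

theorem continuous_halfWaveDatum {k : ℕ} {n₀ n₁ : ℝ × (Fin k → ℝ) → ℂ} (h₀ : Integrable n₀)
    (h₁ : Integrable n₁) (σ : ℝ) : Continuous (halfWaveDatum n₀ n₁ σ) := by
  have := continuous_FT h₀
  have := continuous_FT h₁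
  have := continuous_nsq (k := k)
  unfold halfWaveDatum
  fun_prop

theorem integrable_halfWaveDatum {k : ℕ} {lam : ℝ} {n₀ n₁ : ℝ × (Fin k → ℝ) → ℂ}
    (h₀ : Integrable n₀) (h₁ : Integrable n₁) (hs₀ : ∀ ξ, ¬ inA lam ξ → FT n₀ ξ = 0)
    (hs₁ : ∀ ξ, ¬ inA lam ξ → FT n₁ ξ = 0) (σ : ℝ) : Integrable (halfWaveDatum n₀ n₁ σ) :=
  integrable_of_annulus (lam := lam) (continuous_halfWaveDatum h₀ h₁ σ) fun ξ hξ => by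
    simp [halfWaveDatum, hs₀ ξ hξ, hs₁ ξ hξ]

theorem halfWave_symbol_identity (r s t : ℝ) (f g : ℂ) :
    Complex.exp (Complex.I * r) *
        (((-Real.sin (t * s) * s : ℝ) : ℂ) * f + (Real.cos (t * s) : ℂ) * g) =
      Complex.exp (Complex.I * ((r + t * (1 * s) : ℝ) : ℂ)) *
          ((g + ((1 : ℝ) : ℂ) * Complex.I * s * f) / 2) +
        Complex.exp (Complex.I * ((r + t * (-1 * s) : ℝ) : ℂ)) *
          ((g + ((-1 : ℝ) : ℂ) * Complex.I * s * f) / 2) := by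
  have h1 : Complex.exp (Complex.I * ((r + t * (1 * s) : ℝ) : ℂ)) =
      Complex.exp (Complex.I * r) *
        (Complex.cos ((t * s : ℝ) : ℂ) + Complex.sin ((t * s : ℝ) : ℂ) * Complex.I) := by
    rw [← Complex.exp_mul_I, ← Complex.exp_add]
    congr 1; push_cast; ring
  have h2 : Complex.exp (Complex.I * ((r + t * (-1 * s) : ℝ) : ℂ)) =
      Complex.exp (Complex.I * r) *
        (Complex.cos ((t * s : ℝ) : ℂ) - Complex.sin ((t * s : ℝ) : ℂ) * Complex.I) := by
    rw [← Complex.cos_neg, sub_eq_add_neg, ← neg_mul, ← Complex.sin_neg, ← Complex.exp_mul_I,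
      ← Complex.exp_add]
    congr 1; push_cast; ring
  rw [h1, h2, Complex.ofReal_mul, Complex.ofReal_neg, Complex.ofReal_sin, Complex.ofReal_cos]
  generalize Complex.sin ((t * s : ℝ) : ℂ) = S
  generalize Complex.cos ((t * s : ℝ) : ℂ) = K
  push_cast
  linear_combination (-Complex.exp (Complex.I * r) * S * s * f) * Complex.I_sq

theorem integrable_oscillatory {k : ℕ} {h : ℝ × (Fin k → ℝ) → ℝ} (hh : Measurable h)
    {a : ℝ × (Fin k → ℝ) → ℂ} (ha : Integrable a) (t : ℝ) (x : ℝ × (Fin k → ℝ)) :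
    Integrable fun ξ => Complex.exp (Complex.I * ((dotp x ξ + t * h ξ : ℝ) : ℂ)) * a ξ := by
  refine ha.bdd_mul (c := 1) (Measurable.aestronglyMeasurable ?_)
    (Filter.Eventually.of_forall fun ξ => (norm_exp_I_mul_ofReal' _).le)
  unfold dotp
  fun_prop

theorem hasDerivAt_waveEvol {k : ℕ} {lam : ℝ} (hlam : 0 < lam) {n₀ n₁ : ℝ × (Fin k → ℝ) → ℂ}
    (h₀ : Integrable n₀) (h₁ : Integrable n₁) (hs₀ : ∀ ξ, ¬ inA lam ξ → FT n₀ ξ = 0)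
    (hs₁ : ∀ ξ, ¬ inA lam ξ → FT n₁ ξ = 0) (t : ℝ) (x : ℝ × (Fin k → ℝ)) :
    HasDerivAt (fun τ => waveEvol n₀ n₁ τ x)
      (((2 * Real.pi) ^ (k + 1) : ℝ)⁻¹ •
        (oscillatoryEvol (fun ξ => 1 * Real.sqrt (nsq ξ)) (halfWaveDatum n₀ n₁ 1) t x +
          oscillatoryEvol (fun ξ => -1 * Real.sqrt (nsq ξ)) (halfWaveDatum n₀ n₁ (-1)) t x)) t := by
  have c₀ := continuous_FT h₀
  have c₁ := continuous_FT h₁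
  have cn := continuous_nsq (k := k)
  have cd : Continuous fun ξ => dotp x ξ := by unfold dotp; fun_prop
  have i₀ := integrable_of_annulus c₀ hs₀
  have i₁ := integrable_of_annulus c₁ hs₁
  have i₀' : Integrable fun ξ => (Real.sqrt (nsq ξ) : ℂ) * FT n₀ ξ :=
    integrable_of_annulus (lam := lam) (by fun_prop) fun ξ hξ => by rw [hs₀ ξ hξ, mul_zero]
  have i₁' : Integrable fun ξ => ((Real.sqrt (nsq ξ))⁻¹ : ℂ) * FT n₁ ξ := by
    refine (i₁.norm.const_mul (8 * lam / 9)⁻¹).mono (by fun_prop)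
      (Filter.Eventually.of_forall fun ξ => ?_)
    by_cases hξ : inA lam ξ
    · rw [norm_mul, norm_mul, norm_norm, norm_inv, Complex.norm_real, norm_inv,
        Real.norm_of_nonneg (Real.sqrt_nonneg _), Real.norm_of_nonneg (by positivity)]
      exact mul_le_mul_of_nonneg_right (inv_anti₀ (by positivity) hξ.1) (norm_nonneg _)
    · simp [hs₁ ξ hξ]
  have hnorm : ∀ τ s : ℝ, ∀ f g : ℂ, ∀ r : ℝ, |τ| ≤ 1 → |s| ≤ 1 →
      ‖Complex.exp (Complex.I * (r : ℂ)) * ((τ : ℂ) * f + (s : ℂ) * g)‖ ≤ ‖f‖ + ‖g‖ := by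
    intro τ s f g r hτ hs
    rw [norm_mul, norm_exp_I_mul_ofReal', one_mul]
    refine (norm_add_le _ _).trans (add_le_add ?_ ?_)
    · rw [norm_mul, Complex.norm_real]
      exact mul_le_of_le_one_left (norm_nonneg _) hτ
    · rw [norm_mul, Complex.norm_real]
      exact mul_le_of_le_one_left (norm_nonneg _) hs
  have key := hasDerivAt_integral_of_dominated_loc_of_deriv_le (μ := volume) (x₀ := t)
    (s := Set.univ) Filter.univ_mem
    (F := fun (τ : ℝ) ξ => Complex.exp (Complex.I * (dotp x ξ : ℂ)) *
        ((Real.cos (τ * Real.sqrt (nsq ξ)) : ℂ) * FT n₀ ξ +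
         ((Real.sin (τ * Real.sqrt (nsq ξ)) / Real.sqrt (nsq ξ) : ℝ) : ℂ) * FT n₁ ξ))
    (F' := fun (τ : ℝ) ξ => Complex.exp (Complex.I * (dotp x ξ : ℂ)) *
        (((-Real.sin (τ * Real.sqrt (nsq ξ)) * Real.sqrt (nsq ξ) : ℝ) : ℂ) * FT n₀ ξ +
          (Real.cos (τ * Real.sqrt (nsq ξ)) : ℂ) * FT n₁ ξ))
    (bound := fun ξ => ‖(Real.sqrt (nsq ξ) : ℂ) * FT n₀ ξ‖ + ‖FT n₁ ξ‖)
    ?_ ?_ ?_ ?_ (i₀'.norm.add i₁.norm) ?_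
  · unfold waveEvol
    refine (key.2.const_smul (((2 * Real.pi) ^ (k + 1) : ℝ)⁻¹)).congr_deriv ?_
    congr 1
    unfold oscillatoryEvol
    rw [← integral_add]
    · congr 1 with ξ
      exact halfWave_symbol_identity _ _ _ _ _
    · exact integrable_oscillatory (by fun_prop) (integrable_halfWaveDatum h₀ h₁ hs₀ hs₁ 1) t x
    · exact integrable_oscillatory (by fun_prop) (integrable_halfWaveDatum h₀ h₁ hs₀ hs₁ (-1)) t x
  · refine Filter.Eventually.of_forall fun τ => Measurable.aestronglyMeasurable ?_
    fun_prop
  · refine (i₀.norm.add i₁'.norm).mono' (Measurable.aestronglyMeasurable (by fun_prop))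
      (Filter.Eventually.of_forall fun ξ => ?_)
    have := hnorm (Real.cos (t * Real.sqrt (nsq ξ))) (Real.sin (t * Real.sqrt (nsq ξ)))
      (FT n₀ ξ) (((Real.sqrt (nsq ξ))⁻¹ : ℂ) * FT n₁ ξ) (dotp x ξ) (Real.abs_cos_le_one _)
      (Real.abs_sin_le_one _)
    refine le_trans (le_of_eq ?_) this
    rw [Complex.ofReal_div, div_eq_mul_inv, mul_assoc]
  · exact Measurable.aestronglyMeasurable (by fun_prop)
  · refine Filter.Eventually.of_forall fun ξ τ _ => ?_
    have := hnorm (-Real.sin (τ * Real.sqrt (nsq ξ))) (Real.cos (τ * Real.sqrt (nsq ξ)))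
      ((Real.sqrt (nsq ξ) : ℂ) * FT n₀ ξ) (FT n₁ ξ) (dotp x ξ)
      (by rw [abs_neg]; exact Real.abs_sin_le_one _) (Real.abs_cos_le_one _)
    refine le_trans (le_of_eq ?_) this
    rw [Complex.ofReal_mul, mul_assoc]
  · refine Filter.Eventually.of_forall fun ξ τ _ => ?_
    refine HasDerivAt.const_mul _ ?_
    have hlin : HasDerivAt (fun τ : ℝ => τ * Real.sqrt (nsq ξ)) (Real.sqrt (nsq ξ)) τ := by
      simpa using (hasDerivAt_id τ).mul_const (Real.sqrt (nsq ξ))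
    refine HasDerivAt.add (HasDerivAt.mul_const (hlin.cos.ofReal_comp) _) ?_
    by_cases hξ : inA lam ξ
    · have hne : Real.sqrt (nsq ξ) ≠ 0 := by
        have := hξ.1
        have : 0 < 8 * lam / 9 := by positivity
        linarith
      have := hlin.sin.div_const (Real.sqrt (nsq ξ))
      rw [mul_div_cancel_right₀ _ hne] at this
      exact HasDerivAt.mul_const this.ofReal_comp _
    · simp only [hs₁ ξ hξ, mul_zero]
      exact hasDerivAt_const _ _


instance hasTemperateGrowth_volume_prod {k : ℕ} :
    (volume : Measure (ℝ × (Fin k → ℝ))).HasTemperateGrowth := by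
  have : (volume : Measure (ℝ × (Fin k → ℝ))).IsAddHaarMeasure :=
    Measure.prod.instIsAddHaarMeasure _ _
  infer_instance

theorem lintegral_enorm_sq_schwartz {k : ℕ} {V : Type*} [NormedAddCommGroup V] [NormedSpace ℝ V]
    (f : SchwartzMap (ℝ × (Fin k → ℝ)) V) :
    ∫⁻ x, ‖f x‖ₑ ^ 2 = ENNReal.ofReal (∫ x, ‖f x‖ ^ 2) := by
  have hm := f.memLp 2 (volume : Measure (ℝ × (Fin k → ℝ)))
  rw [ofReal_integral_eq_lintegral_ofReal
    ((memLp_two_iff_integrable_sq_norm hm.aestronglyMeasurable).1 hm)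
    (Filter.Eventually.of_forall fun x => sq_nonneg _)]
  congr 1 with x
  rw [ENNReal.ofReal_pow (norm_nonneg _), ofReal_norm]

theorem lintegral_FT_schwartz_le {k : ℕ} (u : SchwartzMap (ℝ × (Fin k → ℝ)) ℂ) :
    ∫⁻ ξ, ‖FT u ξ‖ₑ ^ 2 ≤
      ENNReal.ofReal (2 * (2 * Real.pi) ^ (k + 1) * ∫ x, ‖u x‖ ^ 2) := by
  refine (lintegral_FT_sq_le u.continuous.measurable u.integrable).trans (le_of_eq ?_)
  rw [lintegral_enorm_sq_schwartz, ENNReal.ofReal_mul (by positivity),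
    ENNReal.ofReal_mul zero_le_two, ENNReal.ofReal_ofNat]

theorem lintegral_FT_schwartz_real_le {k : ℕ} (u : SchwartzMap (ℝ × (Fin k → ℝ)) ℝ) :
    ∫⁻ ξ, ‖FT (fun z => (u z : ℂ)) ξ‖ₑ ^ 2 ≤
      ENNReal.ofReal (2 * (2 * Real.pi) ^ (k + 1) * ∫ x, u x ^ 2) := by
  have hn : ∀ x, ‖(u x : ℂ)‖ₑ = ‖u x‖ₑ := fun x => by
    rw [← ofReal_norm, Complex.norm_real, ofReal_norm]
  refine (lintegral_FT_sq_le (u := fun z => (u z : ℂ))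
    (Complex.measurable_ofReal.comp u.continuous.measurable) u.integrable.ofReal).trans
      (le_of_eq ?_)
  simp only [hn]
  rw [lintegral_enorm_sq_schwartz, ENNReal.ofReal_mul (by positivity),
    ENNReal.ofReal_mul zero_le_two, ENNReal.ofReal_ofNat]
  simp only [Real.norm_eq_abs, sq_abs]

theorem norm_halfWaveDatum_sq_le {k : ℕ} {lam : ℝ} (hlam : 0 ≤ lam)
    {n₀ n₁ : ℝ × (Fin k → ℝ) → ℂ} (hs₀ : ∀ ξ, ¬ inA lam ξ → FT n₀ ξ = 0) {σ : ℝ} (hσ : |σ| ≤ 1)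
    (ξ : ℝ × (Fin k → ℝ)) :
    ‖halfWaveDatum n₀ n₁ σ ξ‖ ^ 2 ≤ ‖FT n₁ ξ‖ ^ 2 + 9 * lam ^ 2 * ‖FT n₀ ξ‖ ^ 2 := by
  have h1 : ‖(σ : ℂ) * Complex.I * (Real.sqrt (nsq ξ) : ℂ) * FT n₀ ξ‖ ≤ 3 * lam * ‖FT n₀ ξ‖ := by
    by_cases hξ : inA lam ξ
    · rw [norm_mul, norm_mul, norm_mul, Complex.norm_I, Complex.norm_real, Complex.norm_real,
        Real.norm_of_nonneg (Real.sqrt_nonneg _), mul_one]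
      refine mul_le_mul_of_nonneg_right ?_ (norm_nonneg _)
      have := hξ.2
      calc ‖σ‖ * Real.sqrt (nsq ξ) ≤ 1 * (9 * lam / 4) :=
            mul_le_mul hσ this (Real.sqrt_nonneg _) zero_le_one
        _ ≤ 3 * lam := by linarith
    · simp [hs₀ ξ hξ]
  have h2 : ‖halfWaveDatum n₀ n₁ σ ξ‖ ≤ (‖FT n₁ ξ‖ + 3 * lam * ‖FT n₀ ξ‖) / 2 := by
    unfold halfWaveDatum
    rw [norm_div, Complex.norm_ofNat]
    have := norm_add_le (FT n₁ ξ) ((σ : ℂ) * Complex.I * (Real.sqrt (nsq ξ) : ℂ) * FT n₀ ξ)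
    linarith
  have h3 := pow_le_pow_left₀ (norm_nonneg _) h2 2
  nlinarith [sq_nonneg (‖FT n₁ ξ‖ - 3 * lam * ‖FT n₀ ξ‖), sq_nonneg (‖FT n₁ ξ‖),
    sq_nonneg (lam * ‖FT n₀ ξ‖)]

theorem lintegral_halfWaveDatum_le {k : ℕ} {lam : ℝ} (hlam : 0 ≤ lam)
    (n₀ n₁ : SchwartzMap (ℝ × (Fin k → ℝ)) ℝ)
    (hs₀ : ∀ ξ, ¬ inA lam ξ → FT (fun z => (n₀ z : ℂ)) ξ = 0) {σ : ℝ} (hσ : |σ| ≤ 1) :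
    ∫⁻ ξ, ‖halfWaveDatum (fun z => (n₀ z : ℂ)) (fun z => (n₁ z : ℂ)) σ ξ‖ₑ ^ 2 ≤
      ENNReal.ofReal (2 * (2 * Real.pi) ^ (k + 1) *
        ((∫ x, n₁ x ^ 2) + 9 * lam ^ 2 * ∫ x, n₀ x ^ 2)) := by
  have he : ∀ z : ℂ, ENNReal.ofReal (‖z‖ ^ 2) = ‖z‖ₑ ^ 2 := fun z => by
    rw [ENNReal.ofReal_pow (norm_nonneg _), ofReal_norm]
  have hm₀ := (continuous_FT (u := fun z => (n₀ z : ℂ))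
    (n₀.integrable (μ := volume)).ofReal).measurable
  have hm₁ := (continuous_FT (u := fun z => (n₁ z : ℂ))
    (n₁.integrable (μ := volume)).ofReal).measurable
  have hi₀ : 0 ≤ ∫ x, n₀ x ^ 2 := integral_nonneg fun x => sq_nonneg _
  have hi₁ : 0 ≤ ∫ x, n₁ x ^ 2 := integral_nonneg fun x => sq_nonneg _
  calc ∫⁻ ξ, ‖halfWaveDatum (fun z => (n₀ z : ℂ)) (fun z => (n₁ z : ℂ)) σ ξ‖ₑ ^ 2
      ≤ ∫⁻ ξ, (‖FT (fun z => (n₁ z : ℂ)) ξ‖ₑ ^ 2 +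
          ENNReal.ofReal (9 * lam ^ 2) * ‖FT (fun z => (n₀ z : ℂ)) ξ‖ₑ ^ 2) := by
        refine lintegral_mono fun ξ => ?_
        rw [← he, ← he, ← he, ← ENNReal.ofReal_mul (by positivity),
          ← ENNReal.ofReal_add (by positivity) (by positivity)]
        exact ENNReal.ofReal_le_ofReal (norm_halfWaveDatum_sq_le hlam hs₀ hσ ξ)
    _ = (∫⁻ ξ, ‖FT (fun z => (n₁ z : ℂ)) ξ‖ₑ ^ 2) +
          ENNReal.ofReal (9 * lam ^ 2) * ∫⁻ ξ, ‖FT (fun z => (n₀ z : ℂ)) ξ‖ₑ ^ 2 := by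
        rw [lintegral_add_left (by fun_prop), lintegral_const_mul _ (by fun_prop)]
    _ ≤ ENNReal.ofReal (2 * (2 * Real.pi) ^ (k + 1) * ∫ x, n₁ x ^ 2) +
          ENNReal.ofReal (9 * lam ^ 2) *
            ENNReal.ofReal (2 * (2 * Real.pi) ^ (k + 1) * ∫ x, n₀ x ^ 2) :=
        add_le_add (lintegral_FT_schwartz_real_le n₁)
          (mul_le_mul_right (lintegral_FT_schwartz_real_le n₀) _)
    _ = _ := by
        rw [← ENNReal.ofReal_mul (by positivity), ← ENNReal.ofReal_add (by positivity)
          (by positivity)]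
        congr 1
        ring

/-- Bilinear estimate for a half-wave and a Schrödinger wave of frequency `μ`. -/
theorem lintegral_halfWave_schrodinger_le {k : ℕ} {mu σ : ℝ} (hσ : |σ| ≤ 1) (hmu : 2 ≤ mu)
    {a b : ℝ × (Fin k → ℝ) → ℂ} (ham : Measurable a) (hai : Integrable a) (hbm : Measurable b)
    (hbi : Integrable b) (hb : ∀ ξ, ¬ (inA mu ξ ∧ inCone ξ) → b ξ = 0) :
    ∫⁻ t, ∫⁻ x, (∫⁻ y : Fin k → ℝ,
          ‖oscillatoryEvol (fun ξ => σ * Real.sqrt (nsq ξ)) a t (x, y)‖ₑ ^ 2) *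
        (∫⁻ y : Fin k → ℝ, ‖oscillatoryEvol (fun ξ => -nsq ξ) b t (x, y)‖ₑ ^ 2) ≤
      ENNReal.ofReal (8 / mu * (2 * Real.pi) ^ (2 * (k + 1))) *
        ((∫⁻ ξ, ‖a ξ‖ₑ ^ 2) * ∫⁻ ξ, ‖b ξ‖ₑ ^ 2) := by
  have hn := continuous_nsq (k := k)
  have h := lintegral_bilinear_le (h₁ := fun ξ => σ * Real.sqrt (nsq ξ)) (h₂ := fun ξ => -nsq ξ)
    (by fun_prop) (by fun_prop) ham hai hbm hbi (S := {ξ | mu / 2 ≤ |ξ.1|})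
    (fun ξ hξ => hb ξ fun h => hξ (half_le_abs_fst (by linarith) h.1 h.2))
    (map_frequency_le hσ (by linarith) (measurableSet_le measurable_const (by fun_prop))
      fun ξ hξ => hξ)
  refine h.trans (le_of_eq ?_)
  congr 1
  have hmu0 : 0 < mu := by linarith
  rw [← ENNReal.ofReal_ofNat 2, ← ENNReal.ofReal_mul (by positivity),
    ← ENNReal.ofReal_mul (by positivity), ← ENNReal.ofReal_mul (by positivity)]
  congr 1
  field_simp
  norm_num

theorem enorm_deriv_re_sq_le {f : ℝ → ℂ} {c : ℝ} {P M : ℂ} {t : ℝ}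
    (h : HasDerivAt f (c • (P + M)) t) :
    ‖deriv (fun τ => (f τ).re) t ^ 2‖ₑ ≤ ENNReal.ofReal (2 * c ^ 2) * (‖P‖ₑ ^ 2 + ‖M‖ₑ ^ 2) := by
  have hd : deriv (fun τ => (f τ).re) t = (c • (P + M)).re :=
    (Complex.reCLM.hasFDerivAt.comp_hasDerivAt t h).deriv
  have he : ∀ z : ℂ, ‖z‖ₑ ^ 2 = ENNReal.ofReal (‖z‖ ^ 2) := fun z => by
    rw [ENNReal.ofReal_pow (norm_nonneg _), ofReal_norm]
  rw [he, he, ← ENNReal.ofReal_add (by positivity) (by positivity),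
    ← ENNReal.ofReal_mul (by positivity), ← ofReal_norm, norm_pow, hd]
  refine ENNReal.ofReal_le_ofReal ?_
  have h1 : ‖(c • (P + M)).re‖ ≤ |c| * (‖P‖ + ‖M‖) := by
    refine (Complex.abs_re_le_norm _).trans ?_
    rw [norm_smul]
    exact mul_le_mul_of_nonneg_left (norm_add_le _ _) (norm_nonneg _)
  refine (pow_le_pow_left₀ (norm_nonneg _) h1 2).trans ?_
  rw [mul_pow, sq_abs]
  nlinarith [mul_nonneg (sq_nonneg c) (sq_nonneg (‖P‖ - ‖M‖))]

theorem lintegral_mul_le_of_pointwise {Y : Type*} [MeasureSpace Y]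
    [SFinite (volume : Measure Y)] {N E : ℝ → ℝ → Y → ℝ≥0∞} {P M Q : ℝ × ℝ × Y → ℝ≥0∞}
    (hP : Measurable P) (hM : Measurable M) (hQ : Measurable Q) {α β : ℝ≥0∞}
    (hN : ∀ t x y, N t x y ≤ α * (P (t, x, y) + M (t, x, y)))
    (hE : ∀ t x y, E t x y ≤ β * Q (t, x, y)) (s : Set ℝ) :
    ∫⁻ t in s, ∫⁻ x, (∫⁻ y, N t x y) * ∫⁻ y, E t x y ≤
      α * β * ((∫⁻ t, ∫⁻ x, (∫⁻ y, P (t, x, y)) * ∫⁻ y, Q (t, x, y)) +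
        ∫⁻ t, ∫⁻ x, (∫⁻ y, M (t, x, y)) * ∫⁻ y, Q (t, x, y)) := by
  have hP' : Measurable fun p : ℝ × ℝ => ∫⁻ y, P (p.1, p.2, y) :=
    Measurable.lintegral_prod_right' (f := fun q : (ℝ × ℝ) × Y => P (q.1.1, q.1.2, q.2))
      (by fun_prop)
  have hM' : Measurable fun p : ℝ × ℝ => ∫⁻ y, M (p.1, p.2, y) :=
    Measurable.lintegral_prod_right' (f := fun q : (ℝ × ℝ) × Y => M (q.1.1, q.1.2, q.2))
      (by fun_prop)
  have hQ' : Measurable fun p : ℝ × ℝ => ∫⁻ y, Q (p.1, p.2, y) :=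
    Measurable.lintegral_prod_right' (f := fun q : (ℝ × ℝ) × Y => Q (q.1.1, q.1.2, q.2))
      (by fun_prop)
  have hPQ : Measurable fun p : ℝ × ℝ => (∫⁻ y, P (p.1, p.2, y)) * ∫⁻ y, Q (p.1, p.2, y) :=
    hP'.mul hQ'
  have hMQ : Measurable fun p : ℝ × ℝ => (∫⁻ y, M (p.1, p.2, y)) * ∫⁻ y, Q (p.1, p.2, y) :=
    hM'.mul hQ'
  calc ∫⁻ t in s, ∫⁻ x, (∫⁻ y, N t x y) * ∫⁻ y, E t x y
      ≤ ∫⁻ t, ∫⁻ x, (∫⁻ y, N t x y) * ∫⁻ y, E t x y := setLIntegral_le_lintegral _ _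
    _ ≤ ∫⁻ t, ∫⁻ x, α * β * ((∫⁻ y, P (t, x, y)) * (∫⁻ y, Q (t, x, y)) +
          (∫⁻ y, M (t, x, y)) * ∫⁻ y, Q (t, x, y)) := by
        refine lintegral_mono fun t => lintegral_mono fun x => ?_
        calc (∫⁻ y, N t x y) * ∫⁻ y, E t x y
            ≤ (∫⁻ y, α * (P (t, x, y) + M (t, x, y))) * ∫⁻ y, β * Q (t, x, y) :=
              mul_le_mul' (lintegral_mono (hN t x)) (lintegral_mono (hE t x))
          _ = _ := by
              rw [lintegral_const_mul _ (by fun_prop), lintegral_const_mul _ (by fun_prop),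
                lintegral_add_left (by fun_prop)]
              ring
    _ = ∫⁻ t, α * β * ((∫⁻ x, (∫⁻ y, P (t, x, y)) * ∫⁻ y, Q (t, x, y)) +
          ∫⁻ x, (∫⁻ y, M (t, x, y)) * ∫⁻ y, Q (t, x, y)) := by
        congr 1 with t
        have hP₁ : Measurable fun x => (∫⁻ y, P (t, x, y)) * ∫⁻ y, Q (t, x, y) :=
          hPQ.comp measurable_prodMk_left
        have hM₁ : Measurable fun x => (∫⁻ y, M (t, x, y)) * ∫⁻ y, Q (t, x, y) :=
          hMQ.comp measurable_prodMk_left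
        exact (lintegral_const_mul _ (hP₁.add hM₁)).trans
          (congrArg _ (lintegral_add_left hP₁ _))
    _ = _ := by
        have hP₂ : Measurable fun t => ∫⁻ x, (∫⁻ y, P (t, x, y)) * ∫⁻ y, Q (t, x, y) :=
          Measurable.lintegral_prod_right' hPQ
        have hM₂ : Measurable fun t => ∫⁻ x, (∫⁻ y, M (t, x, y)) * ∫⁻ y, Q (t, x, y) :=
          Measurable.lintegral_prod_right' hMQ
        exact (lintegral_const_mul _ (hP₂.add hM₂)).trans
          (congrArg _ (lintegral_add_left hP₂ _))

theorem enorm_integral_mul_le {Y : Type*} [MeasureSpace Y] (N E : ℝ → ℝ → Y → ℝ) (s : Set ℝ) :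
    ‖∫ t in s, ∫ x, (∫ y, N t x y) * ∫ y, E t x y‖ₑ ≤
      ∫⁻ t in s, ∫⁻ x, (∫⁻ y, ‖N t x y‖ₑ) * ∫⁻ y, ‖E t x y‖ₑ := by
  refine (enorm_integral_le_lintegral_enorm _).trans (lintegral_mono fun t => ?_)
  refine (enorm_integral_le_lintegral_enorm _).trans (lintegral_mono fun x => ?_)
  rw [enorm_mul]
  exact mul_le_mul' (enorm_integral_le_lintegral_enorm _) (enorm_integral_le_lintegral_enorm _)

theorem rpow_half_le_of_le {L lam mu e x y : ℝ} (hlam : 0 < lam) (hmu : 0 < mu) (he : 0 ≤ e)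
    (hx : 0 ≤ x) (hy : 0 ≤ y) (h : L ≤ 1152 / mu * (y + lam ^ 2 * x) * e) :
    L ^ ((1 : ℝ) / 2) ≤ 34 * lam * mu ^ (-(1 : ℝ) / 2) * e ^ ((1 : ℝ) / 2) *
      (x ^ ((1 : ℝ) / 2) + lam⁻¹ * y ^ ((1 : ℝ) / 2)) := by
  have hm : mu ^ (-(1 : ℝ) / 2) = (Real.sqrt mu)⁻¹ := by
    rw [neg_div, Real.rpow_neg hmu.le, ← Real.sqrt_eq_rpow]
  rw [hm, ← Real.sqrt_eq_rpow, ← Real.sqrt_eq_rpow, ← Real.sqrt_eq_rpow, ← Real.sqrt_eq_rpow]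
  refine Real.sqrt_le_iff.2 ⟨by positivity, h.trans ?_⟩
  have h2 : (34 * lam * (Real.sqrt mu)⁻¹ * Real.sqrt e * (Real.sqrt x + lam⁻¹ * Real.sqrt y)) ^ 2 =
      1156 / mu * (lam * Real.sqrt x + Real.sqrt y) ^ 2 * e := by
    have : 34 * lam * (Real.sqrt mu)⁻¹ * Real.sqrt e * (Real.sqrt x + lam⁻¹ * Real.sqrt y) =
        34 * (Real.sqrt mu)⁻¹ * Real.sqrt e * (lam * Real.sqrt x + Real.sqrt y) := by
      field_simp
    rw [this, mul_pow, mul_pow, mul_pow, inv_pow, Real.sq_sqrt he, Real.sq_sqrt hmu.le]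
    ring
  rw [h2]
  have h3 : y + lam ^ 2 * x ≤ (lam * Real.sqrt x + Real.sqrt y) ^ 2 := by
    have : 0 ≤ lam * Real.sqrt x * Real.sqrt y := by positivity
    nlinarith [Real.sq_sqrt hx, Real.sq_sqrt hy]
  gcongr
  norm_num

/-- **Bilinear wave–Schrödinger estimate, low-high interaction (for `∂ₜn`).** For every dimension
`d = k + 1 ≥ 2` there are `C > 0` and `μ₀ ≥ 1` such that for `λ ≥ 1`, `μ ≥ μ₀`, wave data
`(n₀, n₁)` with Fourier support in `A_λ` and Schrödinger datum `E₀` with Fourier support in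
`A_μ ∩ {|ξ₁| ≥ 100|ξ'|}`, for all `T > 0`:
`‖ ‖∂ₜn‖_{L²_y} ‖E‖_{L²_y} ‖_{L²_{t,x₁}} ≤ C λ μ^{-1/2} ‖E₀‖_{L²} (‖n₀‖_{L²} + λ⁻¹‖n₁‖_{L²})`. -/
theorem bilinear_low_high_dtn (k : ℕ) (hk : 1 ≤ k) :
    ∃ C : ℝ, 0 < C ∧ ∃ μ₀ : ℝ, 1 ≤ μ₀ ∧
      ∀ (lam mu : ℝ), 1 ≤ lam → μ₀ ≤ mu →
      ∀ (n₀ n₁ : SchwartzMap (ℝ × (Fin k → ℝ)) ℝ) (E₀ : SchwartzMap (ℝ × (Fin k → ℝ)) ℂ),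
        (∀ ξ : ℝ × (Fin k → ℝ), ¬ inA lam ξ → FT (fun z => (n₀ z : ℂ)) ξ = 0) →
        (∀ ξ : ℝ × (Fin k → ℝ), ¬ inA lam ξ → FT (fun z => (n₁ z : ℂ)) ξ = 0) →
        (∀ ξ : ℝ × (Fin k → ℝ), ¬ (inA mu ξ ∧ inCone ξ) → FT (⇑E₀) ξ = 0) →
        ∀ T : ℝ, 0 < T →
        (∫ t in Set.Icc (0:ℝ) T, ∫ x₁ : ℝ,
            (∫ y : Fin k → ℝ,
              (deriv (fun τ =>
                (waveEvol (fun z => (n₀ z : ℂ)) (fun z => (n₁ z : ℂ)) τ (x₁, y)).re) t) ^ 2) *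
            (∫ y : Fin k → ℝ, ‖schrodingerEvol (⇑E₀) t (x₁, y)‖ ^ 2)) ^ ((1:ℝ)/2) ≤
          C * lam * mu ^ (-(1:ℝ)/2) * (∫ x : ℝ × (Fin k → ℝ), ‖E₀ x‖ ^ 2) ^ ((1:ℝ)/2) *
            ((∫ x : ℝ × (Fin k → ℝ), (n₀ x) ^ 2) ^ ((1:ℝ)/2) +
              lam⁻¹ * (∫ x : ℝ × (Fin k → ℝ), (n₁ x) ^ 2) ^ ((1:ℝ)/2)) := by
  refine ⟨34, by norm_num, 2, one_le_two, ?_⟩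
  intro lam mu hlam hmu n₀ n₁ E₀ hs₀ hs₁ hsE T _
  have hlam0 : 0 < lam := by linarith
  have hmu0 : 0 < mu := by linarith
  have hi₀ : Integrable fun z => (n₀ z : ℂ) := n₀.integrable.ofReal
  have hi₁ : Integrable fun z => (n₁ z : ℂ) := n₁.integrable.ofReal
  have hx : 0 ≤ ∫ x, n₀ x ^ 2 := integral_nonneg fun x => sq_nonneg _
  have hy : 0 ≤ ∫ x, n₁ x ^ 2 := integral_nonneg fun x => sq_nonneg _
  have he : 0 ≤ ∫ x, ‖E₀ x‖ ^ 2 := integral_nonneg fun x => sq_nonneg _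
  refine rpow_half_le_of_le hlam0 hmu0 he hx hy ?_
  have hn := continuous_nsq (k := k)
  have hbc := continuous_FT (E₀.integrable (μ := volume))
  have hbi : Integrable (FT E₀) :=
    integrable_of_annulus (lam := mu) hbc fun ξ hξ => hsE ξ fun h => hξ h.1
  have hQm := measurable_oscillatoryEvol (h := fun ξ => -nsq ξ) (by fun_prop) hbc.measurable
  have hac : ∀ σ, Continuous (halfWaveDatum (fun z => (n₀ z : ℂ)) (fun z => (n₁ z : ℂ)) σ) :=
    continuous_halfWaveDatum hi₀ hi₁
  have hPm : ∀ σ : ℝ, Measurable fun p : ℝ × ℝ × (Fin k → ℝ) =>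
      oscillatoryEvol (fun ξ => σ * Real.sqrt (nsq ξ))
        (halfWaveDatum (fun z => (n₀ z : ℂ)) (fun z => (n₁ z : ℂ)) σ) p.1 p.2 := fun σ =>
    measurable_oscillatoryEvol (by fun_prop) (hac σ).measurable
  set c : ℝ := ((2 * Real.pi) ^ (k + 1))⁻¹ with hc
  have hbil : ∀ σ : ℝ, |σ| ≤ 1 → ∫⁻ t, ∫⁻ x, (∫⁻ y : Fin k → ℝ,
          ‖oscillatoryEvol (fun ξ => σ * Real.sqrt (nsq ξ))
            (halfWaveDatum (fun z => (n₀ z : ℂ)) (fun z => (n₁ z : ℂ)) σ) t (x, y)‖ₑ ^ 2) *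
        (∫⁻ y : Fin k → ℝ, ‖oscillatoryEvol (fun ξ => -nsq ξ) (FT E₀) t (x, y)‖ₑ ^ 2) ≤
      ENNReal.ofReal (8 / mu * (2 * Real.pi) ^ (2 * (k + 1)) *
        (2 * (2 * Real.pi) ^ (k + 1) * ((∫ x, n₁ x ^ 2) + 9 * lam ^ 2 * ∫ x, n₀ x ^ 2) *
          (2 * (2 * Real.pi) ^ (k + 1) * ∫ x, ‖E₀ x‖ ^ 2))) := fun σ hσ => by
    refine (lintegral_halfWave_schrodinger_le hσ hmu (hac σ).measurable
      (integrable_halfWaveDatum hi₀ hi₁ hs₀ hs₁ σ) hbc.measurable hbi hsE).trans ?_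
    rw [ENNReal.ofReal_mul (p := 8 / mu * (2 * Real.pi) ^ (2 * (k + 1))) (by positivity),
      ENNReal.ofReal_mul (p := 2 * (2 * Real.pi) ^ (k + 1) *
        ((∫ x, n₁ x ^ 2) + 9 * lam ^ 2 * ∫ x, n₀ x ^ 2)) (by positivity)]
    exact mul_le_mul_right (mul_le_mul' (lintegral_halfWaveDatum_le hlam0.le n₀ n₁ hs₀ hσ)
      (lintegral_FT_schwartz_le E₀)) _
  have hmain := (enorm_integral_mul_le (fun t x₁ (y : Fin k → ℝ) => (deriv (fun τ =>
      (waveEvol (fun z => (n₀ z : ℂ)) (fun z => (n₁ z : ℂ)) τ (x₁, y)).re) t) ^ 2)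
      (fun t x₁ y => ‖schrodingerEvol (⇑E₀) t (x₁, y)‖ ^ 2) (Set.Icc 0 T)).trans
    (lintegral_mul_le_of_pointwise ((hPm 1).enorm.pow_const 2) ((hPm (-1)).enorm.pow_const 2)
      (hQm.enorm.pow_const 2) (α := ENNReal.ofReal (2 * c ^ 2)) (β := ENNReal.ofReal (c ^ 2))
      (fun t x y => enorm_deriv_re_sq_le
        (hasDerivAt_waveEvol hlam0 hi₀ hi₁ hs₀ hs₁ t (x, y)))
      (fun t x y => by
        rw [schrodingerEvol_eq, norm_smul, mul_pow, enorm_mul, ← hc, ← ofReal_norm,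
          ← ofReal_norm, norm_pow, norm_pow, norm_norm, norm_norm, Real.norm_eq_abs, sq_abs,
          ENNReal.ofReal_pow (norm_nonneg _), ofReal_norm]) (Set.Icc 0 T))
  have hfin := hmain.trans (mul_le_mul_right
    (add_le_add (hbil 1 (by simp)) (hbil (-1) (by simp))) _)
  rw [← ENNReal.ofReal_mul (by positivity), ← ENNReal.ofReal_add (by positivity) (by positivity),
    ← ENNReal.ofReal_mul (by positivity), ← ofReal_norm,
    ENNReal.ofReal_le_ofReal_iff (by positivity)] at hfin
  refine (Real.le_norm_self _).trans (hfin.trans ?_)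
  have hW : (2 * Real.pi) ^ (2 * (k + 1)) = ((2 * Real.pi) ^ (k + 1)) ^ 2 := by
    rw [mul_comm 2 (k + 1), pow_mul]
  have hW0 : (2 * Real.pi) ^ (k + 1) ≠ 0 := by positivity
  rw [hW, hc]
  generalize (2 * Real.pi) ^ (k + 1) = W at hW0
  have hexp : 2 * W⁻¹ ^ 2 * W⁻¹ ^ 2 *
      (8 / mu * W ^ 2 * (2 * W * ((∫ x, n₁ x ^ 2) + 9 * lam ^ 2 * ∫ x, n₀ x ^ 2) *
          (2 * W * ∫ x, ‖E₀ x‖ ^ 2)) +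
        8 / mu * W ^ 2 * (2 * W * ((∫ x, n₁ x ^ 2) + 9 * lam ^ 2 * ∫ x, n₀ x ^ 2) *
          (2 * W * ∫ x, ‖E₀ x‖ ^ 2))) =
      128 / mu * ((∫ x, n₁ x ^ 2) + 9 * lam ^ 2 * ∫ x, n₀ x ^ 2) * ∫ x, ‖E₀ x‖ ^ 2 := by
    field_simp
    ring
  rw [hexp]
  have hcoef : 128 / mu * ((∫ x, n₁ x ^ 2) + 9 * lam ^ 2 * ∫ x, n₀ x ^ 2) ≤
      1152 / mu * ((∫ x, n₁ x ^ 2) + lam ^ 2 * ∫ x, n₀ x ^ 2) := by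
    rw [div_mul_eq_mul_div, div_mul_eq_mul_div]
    refine div_le_div_of_nonneg_right ?_ hmu0.le
    linarith
  exact mul_le_mul_of_nonneg_right hcoef he
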